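/- Let q be a prime power of characteristic p, d = k+m ≤ q−1, k ≥ 1, m ≥ 0, and f ∈ F_q[x] with f(0) = 1. For k+1 ≤ r ≤ d, let N_2^* be the number of pairs ((x_1,…,x_r), h) where x_1,…,x_r ∈ F_q^* are pairwise distinct, h ∈ F_q[x] has degree at most d−r and h(0) = 1, and (1−x_1x)⋯(1−x_rx)h(x) ≡ f(x) (mod x^{m+1}). Then |N_2^* − (q−1)_r q^{k−r}| ≤ ((q−1)/p + m√q + r−1)_r · C(m−1, d−r) · q^{(d−r)/2}. -/

import Mathlib

/-- Falling factorial `(a)_r = a(a-1)⋯(a-r+1)` with real argument. -/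
noncomputable def fallFac (a : ℝ) (r : ℕ) : ℝ := ∏ i ∈ Finset.range r, (a - i)


section Part1
open Polynomial

section Bombieri

/-- one-point filtered algebra data -/
structure OnePt (E : Type*) {A Γ₀ : Type*} [Field E] [CommRing A] [Algebra E A]
    [LinearOrderedCommGroupWithZero Γ₀] (v : Valuation A Γ₀) (γ : Γ₀) (S : Set ℕ) (b : ℕ → A) :
    Prop where
  hγ : 1 < γ
  hv : ∀ n ∈ S, v (b n) = γ ^ n
  span : ∀ x : A, ∃ (I : Finset ℕ) (c : ℕ → E), (∀ i ∈ I, i ∈ S) ∧ x = ∑ i ∈ I, c i • b i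
  scal : ∀ c : E, c ≠ 0 → v (algebraMap E A c) = 1

variable {E A Γ₀ : Type*} [Field E] [CommRing A] [Algebra E A]
    [LinearOrderedCommGroupWithZero Γ₀] {v : Valuation A Γ₀} {γ : Γ₀} {S : Set ℕ} {b : ℕ → A}

theorem ultra_max (hγ : 1 < γ) {ι : Type*} [DecidableEq ι] (I : Finset ι) (hI : I.Nonempty)
    (f : ι → A) (w : ι → ℕ)
    (hw : ∀ i ∈ I, ∀ j ∈ I, w i = w j → i = j) (hf : ∀ i ∈ I, v (f i) = γ ^ w i) :
    ∃ i₀ ∈ I, v (∑ i ∈ I, f i) = γ ^ w i₀ ∧ ∀ i ∈ I, w i ≤ w i₀ := by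
  obtain ⟨i₀, h0, hmax⟩ := Finset.exists_max_image I w hI
  refine ⟨i₀, h0, ?_, hmax⟩
  rw [← Finset.add_sum_erase I f h0, ← hf i₀ h0]
  have hγ0 : 0 < γ := lt_trans zero_lt_one hγ
  apply Valuation.map_add_eq_of_lt_left
  apply Valuation.map_sum_lt
  · rw [hf i₀ h0]; exact (pow_pos hγ0 _).ne'
  · intro i hi
    rw [Finset.mem_erase] at hi
    rw [hf i hi.2, hf i₀ h0]
    apply pow_lt_pow_right₀ hγ
    exact lt_of_le_of_ne (hmax i hi.2) (fun h => hi.1 (hw i hi.2 i₀ h0 h))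

namespace OnePt

theorem v_smul (H : OnePt E v γ S b) {c : E} (hc : c ≠ 0) (x : A) : v (c • x) = v x := by
  rw [Algebra.smul_def, map_mul, H.scal c hc, one_mul]

theorem v_smul_le (H : OnePt E v γ S b) (c : E) (x : A) : v (c • x) ≤ v x := by
  by_cases hc : c = 0
  · simp [hc]
  · exact (H.v_smul hc x).le

theorem coef_zero (H : OnePt E v γ S b) (I : Finset ℕ) (hI : ∀ i ∈ I, i ∈ S) (c : ℕ → E) (n : ℕ)
    (h : v (∑ i ∈ I, c i • b i) ≤ γ ^ n) : ∀ i ∈ I, n < i → c i = 0 := by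
  classical
  intro i hi hni
  by_contra hc
  have hs : ∑ i ∈ I, c i • b i = ∑ i ∈ I.filter (fun i => c i ≠ 0), c i • b i := by
    rw [Finset.sum_filter_of_ne]
    intro x _ hx h0
    exact hx (by simp [h0])
  obtain ⟨i₀, h0, h1, h2⟩ := ultra_max (v := v) H.hγ (I.filter (fun i => c i ≠ 0))
    ⟨i, by simp [hi, hc]⟩ (fun i => c i • b i) id (by simp) (by
      intro j hj
      rw [Finset.mem_filter] at hj
      rw [H.v_smul hj.2, H.hv j (hI j hj.1)]; rfl)
  rw [hs, h1] at h
  have := (pow_le_pow_iff_right₀ H.hγ).1 h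
  have := h2 i (by simp [hi, hc])
  simp only [id] at *
  omega

theorem val_of_ne (H : OnePt E v γ S b) (x : A) (hx : x ≠ 0) : ∃ n, v x = γ ^ n := by
  classical
  obtain ⟨I, c, hI, rfl⟩ := H.span x
  have hs : ∑ i ∈ I, c i • b i = ∑ i ∈ I.filter (fun i => c i ≠ 0), c i • b i := by
    rw [Finset.sum_filter_of_ne]
    intro x _ hx h0
    exact hx (by simp [h0])
  rw [hs] at hx ⊢
  obtain ⟨i₀, h0, h1, h2⟩ := ultra_max (v := v) H.hγ (I.filter (fun i => c i ≠ 0))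
    (by
      by_contra hne
      rw [Finset.not_nonempty_iff_eq_empty] at hne
      rw [hne] at hx; simp at hx) (fun i => c i • b i) id (by simp) (by
      intro j hj
      rw [Finset.mem_filter] at hj
      rw [H.v_smul hj.2, H.hv j (hI j hj.1)]; rfl)
  exact ⟨_, h1⟩

open Classical in
/-- index set -/
noncomputable def Idx (S : Set ℕ) (n : ℕ) : Finset ℕ := (Finset.range (n + 1)).filter (· ∈ S)

theorem mem_Idx {n i : ℕ} : i ∈ Idx S n ↔ i ≤ n ∧ i ∈ S := by
  simp [Idx]

theorem card_Idx_le (n : ℕ) : (Idx S n).card ≤ n + 1 := by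
  classical
  simpa [Idx] using (Finset.card_filter_le (Finset.range (n+1)) (· ∈ S))

theorem card_Idx_ge {g : ℕ} (hg : ∀ n, g ≤ n → n ∈ S) (n : ℕ) : n + 1 ≤ (Idx S n).card + g := by
  classical
  have : (Finset.range (n+1)) ⊆ Idx S n ∪ Finset.range g := by
    intro i hi
    simp only [Finset.mem_union, mem_Idx, Finset.mem_range] at *
    by_cases h : g ≤ i
    · left; exact ⟨by omega, hg i h⟩
    · right; omega
  have h2 := (Finset.card_le_card this).trans (Finset.card_union_le _ _)
  simpa using h2

theorem card_Idx_diff (n M : ℕ) : (Idx S (M + n)).card ≤ (Idx S M).card + n := by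
  classical
  have : Idx S (M + n) ⊆ Idx S M ∪ Finset.Ioc M (M + n) := by
    intro i hi
    simp only [Finset.mem_union, mem_Idx, Finset.mem_Ioc] at *
    by_cases h : i ≤ M
    · left; exact ⟨h, hi.2⟩
    · right; omega
  have h2 := (Finset.card_le_card this).trans (Finset.card_union_le _ _)
  simpa using h2

/-- linear combination -/
noncomputable def lin (b : ℕ → A) (n : ℕ) (c : Idx S n → E) : A := ∑ i, c i • b i

theorem lin_eq (n : ℕ) (c : Idx S n → E) :
    lin b n c = ∑ i ∈ Idx S n, (if h : i ∈ Idx S n then c ⟨i, h⟩ else 0) • b i := by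
  classical
  rw [lin, ← Finset.sum_coe_sort (Idx S n)]
  apply Finset.sum_congr rfl
  intro i _
  simp

theorem lin_le (H : OnePt E v γ S b) (n : ℕ) (c : Idx S n → E) : v (lin b n c) ≤ γ ^ n := by
  apply Valuation.map_sum_le
  intro i _
  refine (H.v_smul_le _ _).trans ?_
  have := mem_Idx.1 i.2
  rw [H.hv _ this.2]
  exact pow_le_pow_right₀ H.hγ.le this.1

theorem exists_lin (H : OnePt E v γ S b) (n : ℕ) (x : A) (hx : v x ≤ γ ^ n) :
    ∃ c : Idx S n → E, lin b n c = x := by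
  classical
  obtain ⟨I, c, hI, rfl⟩ := H.span x
  have h0 := H.coef_zero I hI c n hx
  refine ⟨fun i => if i.1 ∈ I then c i else 0, ?_⟩
  rw [lin, Finset.sum_coe_sort (Idx S n) (fun i => (if i ∈ I then c i else 0) • b i)]
  simp only [ite_smul, zero_smul]
  rw [← Finset.sum_filter, Finset.filter_mem_eq_inter]
  apply Finset.sum_subset Finset.inter_subset_right
  intro i hi hni
  have : n < i := by
    by_contra hh
    apply hni
    rw [Finset.mem_inter, mem_Idx]
    exact ⟨⟨by omega, hI i hi⟩, hi⟩
  rw [h0 i hi this, zero_smul]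

theorem lin_sub (n : ℕ) (c c' : Idx S n → E) : lin b n (c - c') = lin b n c - lin b n c' := by
  simp [lin, sub_smul]

theorem lin_ne_zero (H : OnePt E v γ S b) (n : ℕ) (c : Idx S n → E) (hc : c ≠ 0) :
    lin b n c ≠ 0 := by
  classical
  intro h
  apply hc
  have hγ0 : 0 < γ := lt_trans zero_lt_one H.hγ
  funext i
  by_contra hci
  have hs : lin b n c = ∑ i ∈ Finset.univ.filter (fun i => c i ≠ 0), c i • b i := by
    rw [lin, Finset.sum_filter_of_ne]
    intro x _ hx h0
    exact hx (by simp [h0])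
  obtain ⟨i₀, h0, h1, h2⟩ := ultra_max (v := v) H.hγ (Finset.univ.filter (fun i => c i ≠ 0))
    ⟨i, by simpa using hci⟩ (fun i => c i • b i) (fun i => i.1)
    (by intro i _ j _ h; exact Subtype.ext h) (by
      intro j hj
      rw [Finset.mem_filter] at hj
      rw [H.v_smul hj.2, H.hv j (mem_Idx.1 j.2).2])
  rw [← hs, h, map_zero] at h1
  exact (pow_pos hγ0 _).ne h1

theorem lin_inj (H : OnePt E v γ S b) (n : ℕ) : Function.Injective (lin (E := E) (S := S) b n) := by
  intro c c' h
  by_contra hne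
  exact H.lin_ne_zero n (c - c') (sub_ne_zero.2 hne) (by rw [lin_sub, h, sub_self])

/-- zeros of a function -/
theorem zeros_le [Fintype E] (H : OnePt E v γ S b) (f : A) (hf : f ≠ 0) (n : ℕ) (hn : v f ≤ γ ^ n)
    (pts : Finset (A →ₐ[E] E)) (hz : ∀ φ ∈ pts, φ f = 0) : pts.card ≤ n := by
  classical
  -- surjectivity of evaluation
  let ev : A →ₗ[E] (pts → E) := LinearMap.pi (fun φ => φ.1.toLinearMap)
  have hsurj : Function.Surjective ev := by
    have hc : Pairwise fun (i j : pts) => IsCoprime (RingHom.ker i.1) (RingHom.ker j.1) := by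
      intro i j hij
      have hmi : ∀ i : A →ₐ[E] E, (RingHom.ker i).IsMaximal := fun i =>
        RingHom.ker_isMaximal_of_surjective i (fun c => ⟨algebraMap E A c, by simp⟩)
      have := hmi i.1
      have := hmi j.1
      rw [Ideal.isCoprime_iff_sup_eq]
      apply Ideal.IsMaximal.coprime_of_ne (hmi i.1) (hmi j.1)
      intro h
      apply hij
      apply Subtype.ext
      ext x
      have hx : x - algebraMap E A (i.1 x) ∈ RingHom.ker i.1 := by simp [RingHom.mem_ker]
      rw [h, RingHom.mem_ker] at hx
      simp only [map_sub, AlgHom.commutes] at hx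
      exact (sub_eq_zero.1 hx).symm
    intro y
    obtain ⟨z, hz⟩ := Ideal.exists_forall_sub_mem_ideal 
      (I := fun i : pts => RingHom.ker i.1) hc (fun i => algebraMap E A (y i))
    refine ⟨z, ?_⟩
    funext i
    have := hz i
    rw [RingHom.mem_ker] at this
    simp only [map_sub, AlgHom.commutes] at this
    exact sub_eq_zero.1 this
  choose e he using fun i : pts => hsurj (Pi.single i 1)
  have hbd : ∃ M, ∀ i : pts, v (e i) ≤ γ ^ M := by
    have : ∀ i : pts, ∃ M, v (e i) ≤ γ ^ M := by
      intro i
      by_cases h : e i = 0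
      · exact ⟨0, by simp [h]⟩
      · obtain ⟨M, hM⟩ := H.val_of_ne _ h
        exact ⟨M, hM.le⟩
    choose M hM using this
    refine ⟨∑ i, M i, fun i => (hM i).trans (pow_le_pow_right₀ H.hγ.le ?_)⟩
    exact Finset.single_le_sum (f := M) (by simp) (Finset.mem_univ i)
  obtain ⟨M, hM⟩ := hbd
  have hvf : v f ≠ 0 := by
    obtain ⟨k, hk⟩ := H.val_of_ne f hf
    rw [hk]; exact (pow_pos (lt_trans zero_lt_one H.hγ) _).ne'
  let Ψ : (pts → E) × (Idx S M → E) → A := fun x => ∑ i, x.1 i • e i + f * lin b M x.2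
  have hΨ : ∀ x, v (Ψ x) ≤ γ ^ (M + n) := by
    intro x
    apply Valuation.map_add_le
    · apply Valuation.map_sum_le
      intro i _
      exact ((H.v_smul_le _ _).trans (hM i)).trans (pow_le_pow_right₀ H.hγ.le (by omega))
    · rw [map_mul, add_comm, pow_add]
      exact mul_le_mul' hn (H.lin_le M _)
  choose c hc using fun x => H.exists_lin (M + n) (Ψ x) (hΨ x)
  have hcinj : Function.Injective c := by
    intro x y hxy
    have h1 : Ψ x = Ψ y := by rw [← hc, ← hc, hxy]
    have hfst : ∀ x, ev (Ψ x) = x.1 := by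
      intro x
      have hfz : ∀ z, ev (f * z) = 0 := by
        intro z; funext i
        simp [ev, hz i.1 i.2]
      simp only [Ψ, map_add, map_sum, map_smul, he, hfz, add_zero]
      funext j
      simp [Finset.sum_apply, Pi.single_apply]
    have h2 : x.1 = y.1 := by rw [← hfst, ← hfst, h1]
    have h3 : f * (lin b M x.2 - lin b M y.2) = 0 := by
      simp only [Ψ, h2] at h1
      rw [mul_sub, sub_eq_zero]; exact add_left_cancel h1
    have h4 : x.2 = y.2 := by
      by_contra hne
      have h5 := H.lin_ne_zero M _ (sub_ne_zero.2 hne)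
      rw [lin_sub] at h5
      obtain ⟨k, hk⟩ := H.val_of_ne _ h5
      have := congrArg v h3
      rw [map_mul, hk, map_zero] at this
      exact (mul_ne_zero hvf (pow_pos (lt_trans zero_lt_one H.hγ) _).ne') this
    exact Prod.ext h2 h4
  have hcard := Fintype.card_le_of_injective c hcinj
  simp only [Fintype.card_prod, Fintype.card_fun, Fintype.card_coe, ← pow_add] at hcard
  have h6 := (Nat.pow_le_pow_iff_right Fintype.one_lt_card).1 hcard
  have h7 := card_Idx_diff (S := S) n M
  omega

theorem bombieri [Fintype E] (H : OnePt E v γ S b) (g : ℕ) (hg : ∀ n, g ≤ n → n ∈ S)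
    (p e : ℕ) [Fact p.Prime] [CharP E p] (hE : Fintype.card E = p ^ e * p ^ e)
    (ht : g ^ 2 + 3 * g + 1 < p ^ e)
    (pts : Finset (A →ₐ[E] E)) : pts.card ≤ p ^ e * p ^ e + (2 * g + 1) * p ^ e := by
  classical
  rcases pts.eq_empty_or_nonempty with rfl | ⟨φ₀, -⟩
  · simp
  have : Nontrivial A := φ₀.toRingHom.domain_nontrivial
  have : CharP A p := charP_of_injective_algebraMap (algebraMap E A).injective p
  have : ExpChar A p := ExpChar.prime Fact.out
  have : ExpChar E p := ExpChar.prime Fact.out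
  set t := p ^ e with htdef
  have ht1 : 1 ≤ t := by omega
  let j := t - 1
  let k := t + 2 * g
  let F1 : (Idx S k → Idx S j → E) → A := fun c => ∑ i, (lin b j (c i)) ^ t * b i
  have hF1 : ∀ c, v (F1 c) ≤ γ ^ (j * t + k) := by
    intro c
    apply Valuation.map_sum_le
    intro i _
    rw [map_mul, map_pow, pow_add, pow_mul]
    refine mul_le_mul' (pow_le_pow_left₀ zero_le (H.lin_le j _) t) ?_
    have := mem_Idx.1 i.2
    rw [H.hv _ this.2]
    exact pow_le_pow_right₀ H.hγ.le this.1
  have hsub : ∀ c c', F1 (c - c') = F1 c - F1 c' := by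
    intro c c'
    simp only [F1, ← Finset.sum_sub_distrib]
    apply Finset.sum_congr rfl
    intro i _
    rw [Pi.sub_apply, lin_sub, htdef, sub_pow_expChar_pow, sub_mul]
  choose c hc using fun x => H.exists_lin (j * t + k) (F1 x) (hF1 x)
  have hlt : Fintype.card (Idx S (j * t + k) → E) < Fintype.card (Idx S k → Idx S j → E) := by
    simp only [Fintype.card_fun, Fintype.card_coe, ← pow_mul]
    apply Nat.pow_lt_pow_right Fintype.one_lt_card
    have h1 := card_Idx_le (S := S) (j * t + k)
    have h2 := card_Idx_ge hg k
    have h3 := card_Idx_ge hg j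
    have h4 : (t - g) * (t + g + 1) ≤ (Idx S j).card * (Idx S k).card := by
      apply Nat.mul_le_mul <;> omega
    refine lt_of_lt_of_le (lt_of_le_of_lt h1 ?_) h4
    have hgt : g ≤ t := by nlinarith
    obtain ⟨s, hs⟩ : ∃ s, t = s + 1 := ⟨t - 1, by omega⟩
    have hj : j = s := by omega
    obtain ⟨r, hr⟩ : ∃ r, t = g + r := ⟨t - g, by omega⟩
    have : t - g = r := by omega
    rw [this, hj]
    simp only [k]
    have e1 : s * t + t = t * t := by rw [hs]; ring
    have e2 : r * (t + g + 1) + g * g + g = t * t + t := by rw [hr]; ring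
    nlinarith
  obtain ⟨x, y, hxy, hcxy⟩ := Fintype.exists_ne_map_eq_of_card_lt c hlt
  have hF : F1 (x - y) = 0 := by rw [hsub, ← hc, ← hc, hcxy, sub_self]
  have hz0 : x - y ≠ 0 := sub_ne_zero.2 hxy
  set z := x - y
  let f : A := ∑ i, lin b j (z i) * (b i) ^ t
  have hfv : v f ≤ γ ^ (j + k * t) := by
    apply Valuation.map_sum_le
    intro i _
    rw [map_mul, map_pow, pow_add, pow_mul]
    refine mul_le_mul' (H.lin_le j _) (pow_le_pow_left₀ zero_le ?_ t)
    have := mem_Idx.1 i.2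
    rw [H.hv _ this.2]
    exact pow_le_pow_right₀ H.hγ.le this.1
  have hf0 : f ≠ 0 := by
    intro hf
    obtain ⟨i1, hi1⟩ := Function.ne_iff.1 hz0
    have hs : f = ∑ i ∈ Finset.univ.filter (fun i => z i ≠ 0), lin b j (z i) * (b i) ^ t := by
      rw [Finset.sum_filter_of_ne]
      intro x _ hx h0
      exact hx (by simp [h0, lin])
    have hd : ∀ i, ∃ d, z i ≠ 0 → d ≤ j ∧ v (lin b j (z i)) = γ ^ d := by
      intro i
      by_cases h : z i = 0
      · exact ⟨0, fun h' => absurd h h'⟩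
      · obtain ⟨d, hd⟩ := H.val_of_ne _ (H.lin_ne_zero j _ h)
        refine ⟨d, fun _ => ⟨?_, hd⟩⟩
        have := H.lin_le j (z i)
        rw [hd] at this
        exact (pow_le_pow_iff_right₀ H.hγ).1 this
    choose d hd using hd
    obtain ⟨i₀, h0, h1, h2⟩ := ultra_max (v := v) H.hγ (Finset.univ.filter (fun i => z i ≠ 0))
      ⟨i1, by simpa using hi1⟩ (fun i => lin b j (z i) * (b i) ^ t) (fun i => d i + i.1 * t)
      (by
        intro i hi i' hi' h
        rw [Finset.mem_filter] at hi hi'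
        have a1 := (hd i hi.2).1
        have a2 := (hd i' hi'.2).1
        apply Subtype.ext
        have b1 : (d i + i.1 * t) / t = i.1 := by
          rw [Nat.add_mul_div_right _ _ (by omega), Nat.div_eq_of_lt (by omega), zero_add]
        have b2 : (d i' + i'.1 * t) / t = i'.1 := by
          rw [Nat.add_mul_div_right _ _ (by omega), Nat.div_eq_of_lt (by omega), zero_add]
        rw [← b1, ← b2]; exact congrArg (· / t) h)
      (by
        intro i hi
        rw [Finset.mem_filter] at hi
        rw [map_mul, map_pow, (hd i hi.2).2, H.hv _ (mem_Idx.1 i.2).2, pow_add, pow_mul])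
    rw [← hs, hf, map_zero] at h1
    exact (pow_pos (lt_trans zero_lt_one H.hγ) _).ne h1
  have := H.zeros_le f hf0 (j + k * t) hfv pts (by
    intro φ _
    have h1 : (φ f) ^ t = φ (F1 z) := by
      simp only [f, F1, map_sum]
      rw [htdef, sum_pow_char_pow, ← htdef]
      apply Finset.sum_congr rfl
      intro i _
      rw [map_mul, map_mul, map_pow, map_pow, mul_pow, ← pow_mul, ← hE, FiniteField.pow_card]
    rw [hF, map_zero] at h1
    exact eq_zero_of_pow_eq_zero h1)
  refine this.trans ?_
  simp only [j, k]
  have : (t + 2 * g) * t = t * t + 2 * g * t := by ring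
  rw [this]
  have : (2 * g + 1) * t = 2 * g * t + t := by ring
  omega

end OnePt
end Bombieri

end Part1

section Part2
open Polynomial

section Curve

theorem exists_valued (E : Type) [Field E] : ∃ (K : Type) (_ : Field K) (_ : Algebra E K)
    (_ : IsAlgClosed K) (Γ : Type) (_ : LinearOrderedCommGroupWithZero Γ) (v : Valuation K Γ) (z : K),
    1 < v z := by
  let K := AlgebraicClosure (RatFunc E)
  let y : K := algebraMap (RatFunc E) K RatFunc.X
  have hy0 : y ≠ 0 := by
    simp [y, RatFunc.X_ne_zero]
  let φ : E[X] →+* K := (algebraMap (RatFunc E) K).comp (algebraMap E[X] (RatFunc E))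
  have hφ : Function.Injective φ :=
    (algebraMap (RatFunc E) K).injective.comp (IsFractionRing.injective E[X] (RatFunc E))
  have hφX : φ X = y := by simp [φ, y]
  let A : Subring K := φ.range
  let yA : A := ⟨y, ⟨X, hφX⟩⟩
  have hI : Ideal.span {yA} ≠ ⊤ := by
    intro h
    rw [Ideal.span_singleton_eq_top] at h
    obtain ⟨⟨_, ⟨f, rfl⟩⟩, hf⟩ := h.exists_right_inv
    have h2 : φ (X * f) = φ 1 := by
      have := congrArg Subtype.val hf
      simpa [yA, hφX] using this
    have h3 := congrArg (Polynomial.eval 0) (hφ h2)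
    simp at h3
  obtain ⟨V, hV, hV2⟩ := Ideal.image_subset_nonunits_valuationSubring (Ideal.span {yA}) hI
  have hy : y ∈ V.nonunits := hV2 ⟨yA, Ideal.subset_span rfl, rfl⟩
  rw [ValuationSubring.mem_nonunits_iff] at hy
  refine ⟨K, inferInstance, inferInstance, inferInstance, V.ValueGroup, inferInstance, V.valuation,
    y⁻¹, ?_⟩
  rw [map_inv₀]
  exact (one_lt_inv₀ (by simpa [zero_lt_iff] using hy0)).2 hy

/-- weights -/
def wtw (q m i : ℕ) : ℕ := q ^ (m - i) * ∑ l ∈ Finset.range i, q ^ l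

theorem wtw_succ (q m i : ℕ) (h : i < m) : q * wtw q m (i + 1) = q ^ m + wtw q m i := by
  unfold wtw
  rw [Finset.sum_range_succ, ← mul_assoc, ← pow_succ']
  have : m - (i + 1) + 1 = m - i := by omega
  rw [this, mul_add, ← pow_add]
  have : m - i + i = m := by omega
  rw [this, add_comm]

theorem wtw_lt (q m i j : ℕ) (hq : 2 ≤ q) (hi : i < m) (hj : j < i) : wtw q m j < wtw q m i := by
  obtain ⟨d, rfl⟩ : ∃ d, i = j + 1 + d := ⟨i - j - 1, by omega⟩
  clear hj
  have step : ∀ i, i < m → wtw q m i < wtw q m (i+1) := by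
    intro i hi
    unfold wtw
    have : m - i = (m - (i+1)) + 1 := by omega
    rw [this, pow_succ, mul_assoc]
    apply Nat.mul_lt_mul_of_pos_left _ (pow_pos (by omega) _)
    rw [Finset.mul_sum, Finset.sum_range_succ']
    simp only [pow_succ']
    simp
  induction d with
  | zero => exact step j (by omega)
  | succ d ih => exact (ih (by omega)).trans (step _ (by omega))

theorem wt_inj_mod (q m : ℕ) (hq : 2 ≤ q) (e e' : Fin m → Fin q)
    (h : ((q : ℤ) ^ m) ∣ ∑ i : Fin m, ((e i : ℤ) - (e' i : ℤ)) * (wtw q m (i + 1) : ℤ)) : e = e' := by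
  classical
  by_contra hne
  obtain ⟨i₁, hi₁⟩ := Function.ne_iff.1 hne
  obtain ⟨i₀, h0, hmax⟩ := Finset.exists_max_image (Finset.univ.filter (fun i => e i ≠ e' i)) id
    ⟨i₁, by simpa using hi₁⟩
  simp only [Finset.mem_filter, Finset.mem_univ, true_and, id] at h0 hmax
  have hq0 : (q : ℤ) ^ (m - 1 - i₀.1) ≠ 0 := by positivity
  have h1 : ((q : ℤ) ^ (m - i₀.1)) ∣ ∑ i : Fin m, ((e i : ℤ) - (e' i : ℤ)) * (wtw q m (i + 1) : ℤ) :=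
    (pow_dvd_pow _ (by omega)).trans h
  rw [← Finset.add_sum_erase _ _ (Finset.mem_univ i₀)] at h1
  have h2 : ((q : ℤ) ^ (m - i₀.1)) ∣ ∑ i ∈ Finset.univ.erase i₀,
      ((e i : ℤ) - (e' i : ℤ)) * (wtw q m (i + 1) : ℤ) := by
    apply Finset.dvd_sum
    intro i hi
    rw [Finset.mem_erase] at hi
    by_cases hee : e i = e' i
    · simp [hee]
    · have hle := hmax i hee
      have hlt : i.1 < i₀.1 := lt_of_le_of_ne hle (fun h => hi.1 (Fin.ext h))
      apply Dvd.dvd.mul_left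
      unfold wtw
      push_cast
      apply Dvd.dvd.mul_right
      exact pow_dvd_pow _ (by omega)
  have h3 := (dvd_add_left h2).1 h1
  have h4 : ((q : ℤ) ^ (m - 1 - i₀.1)) * q ∣ (q : ℤ) ^ (m - 1 - i₀.1) *
      (((e i₀ : ℤ) - (e' i₀ : ℤ)) * (∑ l ∈ Finset.range (i₀ + 1), (q : ℤ) ^ l)) := by
    have e1 : m - i₀.1 = m - 1 - i₀.1 + 1 := by omega
    have e2 : m - (i₀.1 + 1) = m - 1 - i₀.1 := by omega
    rw [e1, pow_succ] at h3
    have e3 : (wtw q m (i₀.1 + 1) : ℤ) = (q : ℤ) ^ (m - 1 - i₀.1) *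
        ∑ l ∈ Finset.range (i₀.1 + 1), (q : ℤ) ^ l := by
      unfold wtw
      push_cast
      rw [e2]
    rw [e3] at h3
    have e4 : (q : ℤ) ^ (m - 1 - i₀.1) *
      (((e i₀ : ℤ) - (e' i₀ : ℤ)) * (∑ l ∈ Finset.range (i₀ + 1), (q : ℤ) ^ l)) =
      ((e i₀ : ℤ) - (e' i₀ : ℤ)) * ((q : ℤ) ^ (m - 1 - i₀.1) *
        ∑ l ∈ Finset.range (i₀.1 + 1), (q : ℤ) ^ l) := by ring
    rw [e4]
    exact h3
  have h5 := Int.dvd_of_mul_dvd_mul_left hq0 h4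
  rw [Finset.sum_range_succ', pow_zero, mul_add, mul_one] at h5
  have h6 : (q : ℤ) ∣ ((e i₀ : ℤ) - (e' i₀ : ℤ)) := by
    refine (dvd_add_right ?_).1 h5
    apply Dvd.dvd.mul_left
    apply Finset.dvd_sum
    intro i _
    exact Dvd.intro_left _ (pow_succ _ _).symm
  have h7 : ((e i₀ : ℤ) - (e' i₀ : ℤ)) = 0 := by
    apply Int.eq_zero_of_abs_lt_dvd h6
    rw [abs_lt]
    have := (e i₀).2
    have := (e' i₀).2
    constructor <;> omega
  apply h0
  apply Fin.ext
  omega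

/-- weight of normal exponent -/
def wtN (q m : ℕ) (x : ℕ × (Fin m → Fin q)) : ℕ :=
  x.1 * q ^ m + ∑ i : Fin m, (x.2 i : ℕ) * wtw q m (i + 1)

theorem wtN_inj (q m : ℕ) (hq : 2 ≤ q) : Function.Injective (wtN q m) := by
  rintro ⟨a, e⟩ ⟨a', e'⟩ h
  have he : e = e' := by
    apply wt_inj_mod q m hq
    refine ⟨(a' : ℤ) - a, ?_⟩
    have h2 : ((a * q ^ m + ∑ i : Fin m, (e i : ℕ) * wtw q m (i + 1) : ℕ) : ℤ) =
      ((a' * q ^ m + ∑ i : Fin m, (e' i : ℕ) * wtw q m (i + 1) : ℕ) : ℤ) := by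
      exact_mod_cast h
    push_cast at h2
    simp only [sub_mul, Finset.sum_sub_distrib]
    linear_combination h2
  subst he
  simp only [wtN, add_left_inj] at h
  have := Nat.eq_of_mul_eq_mul_right (pow_pos (by omega) _) h
  rw [this]

/-- gap bound -/
def gapB (q m : ℕ) : ℕ := ∑ i : Fin m, q * wtw q m (i + 1)

theorem wtN_cofinite (q m : ℕ) (hq : 2 ≤ q) (n : ℕ) (hn : gapB q m ≤ n) :
    n ∈ Set.range (wtN q m) := by
  classical
  have : NeZero (q ^ m) := ⟨(pow_pos (by omega) _).ne'⟩
  let f : (Fin m → Fin q) → ZMod (q ^ m) := fun e => ((∑ i : Fin m, (e i : ℕ) * wtw q m (i + 1) : ℕ) : ZMod (q ^ m))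
  have hinj : Function.Injective f := by
    intro e e' h
    apply wt_inj_mod q m hq
    have h2 : (((∑ i : Fin m, (e i : ℕ) * wtw q m (i + 1) : ℕ) : ℤ) : ZMod (q ^ m)) =
      (((∑ i : Fin m, (e' i : ℕ) * wtw q m (i + 1) : ℕ) : ℤ) : ZMod (q ^ m)) := by
      exact_mod_cast h
    rw [eq_comm, ZMod.intCast_eq_intCast_iff_dvd_sub] at h2
    push_cast at h2
    simpa only [sub_mul, Finset.sum_sub_distrib] using h2
  have hbij : Function.Bijective f := by
    rw [Fintype.bijective_iff_injective_and_card]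
    exact ⟨hinj, by simp [ZMod.card]⟩
  obtain ⟨e, he⟩ := hbij.2 (n : ZMod (q ^ m))
  have hle : ∑ i : Fin m, (e i : ℕ) * wtw q m (i + 1) ≤ n := by
    refine le_trans (Finset.sum_le_sum ?_) hn
    intro i _
    exact Nat.mul_le_mul_right _ (e i).2.le
  rw [ZMod.natCast_eq_natCast_iff] at he
  obtain ⟨k, hk⟩ := (Nat.modEq_iff_dvd' hle).1 he
  refine ⟨(k, e), ?_⟩
  simp only [wtN]
  rw [mul_comm k, ← hk]
  omega

section span
variable {E A : Type*} [Field E] [CommRing A] [Algebra E A] (q m : ℕ) (β : A) (W : ℕ → A)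

/-- monomial -/
def mon (e0 : ℕ) (e : Fin m → ℕ) : A := β ^ e0 * ∏ i : Fin m, W (i + 1) ^ e i

theorem mul_mon (h0 : W 0 = 1) (j : ℕ) (hj : j ≤ m) (e0 : ℕ) (e : Fin m → ℕ) :
    ∃ e' : Fin m → ℕ, W j * mon m β W e0 e = mon m β W e0 e' ∧ ∑ i, e' i ≤ ∑ i, e i + 1 := by
  classical
  rcases j with _ | j
  · exact ⟨e, by simp [h0], by omega⟩
  · let J : Fin m := ⟨j, by omega⟩
    refine ⟨e + Pi.single J 1, ?_, ?_⟩
    · unfold mon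
      simp only [Pi.add_apply, pow_add, Finset.prod_mul_distrib]
      have : ∏ i : Fin m, W (i + 1) ^ (Pi.single J 1 : Fin m → ℕ) i = W (j + 1) := by
        rw [Finset.prod_eq_single J]
        · simp [J]
        · intro b _ hb; simp [Pi.single_apply, hb]
        · simp
      rw [this]; ring
    · simp [Finset.sum_add_distrib, Pi.single_apply]

variable (E) in
/-- span of normal monomials -/
def nspan : Submodule E A :=
  Submodule.span E (Set.range (fun x : ℕ × (Fin m → Fin q) => mon m β W x.1 (fun i => (x.2 i : ℕ))))

theorem mon_mem (hq : 2 ≤ q) (h0 : W 0 = 1) (c : ℕ → ℕ → E)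
    (hrel : ∀ i < m, W (i + 1) ^ q = W (i + 1) + β * ∑ j ∈ Finset.range (i + 1), c i j • W j) :
    ∀ (s e0 : ℕ) (e : Fin m → ℕ), ∑ i, e i ≤ s → mon m β W e0 e ∈ nspan E q m β W := by
  classical
  intro s
  induction s using Nat.strong_induction_on with
  | _ s ih =>
  intro e0 e hs
  by_cases hn : ∀ i, e i < q
  · exact Submodule.subset_span ⟨(e0, fun i => ⟨e i, hn i⟩), rfl⟩
  · push Not at hn
    obtain ⟨i, hi⟩ := hn
    let e' : Fin m → ℕ := Function.update e i (e i - q)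
    have he : e = e' + Pi.single i q := by
      funext k
      by_cases hk : k = i
      · subst hk; simp [e']; omega
      · simp [e', hk]
    have hsum : ∑ k, e k = ∑ k, e' k + q := by
      rw [he]; simp [Finset.sum_add_distrib, Pi.single_apply]
    have hm : mon m β W e0 e = W (i + 1) ^ q * mon m β W e0 e' := by
      rw [he]
      unfold mon
      simp only [Pi.add_apply, pow_add, Finset.prod_mul_distrib]
      have : ∏ k : Fin m, W (k + 1) ^ (Pi.single i q : Fin m → ℕ) k = W (i + 1) ^ q := by
        rw [Finset.prod_eq_single i]
        · simp
        · intro b _ hb; simp [Pi.single_apply, hb]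
        · simp
      rw [this]; ring
    rw [hm, hrel i i.2, add_mul]
    have hβ : β * (∑ j ∈ Finset.range (i + 1), c i j • W j) * mon m β W e0 e' =
        ∑ j ∈ Finset.range (i + 1), c i j • (W j * mon m β W (e0 + 1) e') := by
      rw [Finset.mul_sum, Finset.sum_mul]
      apply Finset.sum_congr rfl
      intro j _
      unfold mon
      rw [pow_succ]
      simp only [Algebra.smul_def]
      ring
    rw [hβ]
    apply Submodule.add_mem
    · obtain ⟨e'', h1, h2⟩ := mul_mon m β W h0 (i + 1) i.2 e0 e'
      rw [h1]
      exact ih (∑ k, e'' k) (by omega) e0 e'' le_rfl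
    · apply Submodule.sum_mem
      intro j hj
      apply Submodule.smul_mem
      rw [Finset.mem_range] at hj
      obtain ⟨e'', h1, h2⟩ := mul_mon m β W h0 j (by omega) (e0 + 1) e'
      rw [h1]
      exact ih (∑ k, e'' k) (by omega) _ e'' le_rfl

theorem nspan_mul (hq : 2 ≤ q) (h0 : W 0 = 1) (c : ℕ → ℕ → E)
    (hrel : ∀ i < m, W (i + 1) ^ q = W (i + 1) + β * ∑ j ∈ Finset.range (i + 1), c i j • W j)
    (x : A) (hx : x ∈ nspan E q m β W) :
    (β * x ∈ nspan E q m β W) ∧ ∀ i < m, W (i + 1) * x ∈ nspan E q m β W := by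
  constructor
  · induction hx using Submodule.span_induction with
    | mem x h =>
      obtain ⟨y, rfl⟩ := h
      have : β * mon m β W y.1 (fun i => (y.2 i : ℕ)) = mon m β W (y.1 + 1) (fun i => (y.2 i : ℕ)) := by
        unfold mon; ring
      simp only [this]
      exact mon_mem q m β W hq h0 c hrel _ _ _ le_rfl
    | zero => simp
    | add x y _ _ hx hy => rw [mul_add]; exact Submodule.add_mem _ hx hy
    | smul a x _ hx => rw [mul_smul_comm]; exact Submodule.smul_mem _ _ hx
  · intro i hi
    induction hx using Submodule.span_induction with
    | mem x h =>
      obtain ⟨y, rfl⟩ := h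
      obtain ⟨e'', h1, h2⟩ := mul_mon m β W h0 (i + 1) hi y.1 (fun i => (y.2 i : ℕ))
      simp only [h1]
      exact mon_mem q m β W hq h0 c hrel _ _ _ le_rfl
    | zero => simp
    | add x y _ _ hx hy => rw [mul_add]; exact Submodule.add_mem _ hx hy
    | smul a x _ hx => rw [mul_smul_comm]; exact Submodule.smul_mem _ _ hx

end span

theorem exists_W {E K Γ : Type*} [Field E] [Fintype E] [Field K] [Algebra E K] [IsAlgClosed K]
    [LinearOrderedCommGroupWithZero Γ] (v : Valuation K Γ) (γ : Γ) (hγ : 1 < γ) (β : K)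
    (q m : ℕ) (hq : 2 ≤ q) (hβ : v β = γ ^ (q ^ m))
    (hscal : ∀ a : E, a ≠ 0 → v (algebraMap E K a) = 1)
    (c : ℕ → ℕ → E) (hc : ∀ i, c i i ≠ 0) : ∀ n ≤ m,
    ∃ W : ℕ → K, W 0 = 1 ∧
      (∀ i < n, W (i + 1) ^ q = W (i + 1) + β * ∑ j ∈ Finset.range (i + 1), c i j • W j) ∧
      (∀ i ≤ n, v (W i) = γ ^ (wtw q m i)) := by
  have hγ0 : 0 < γ := lt_trans zero_lt_one hγ
  intro n
  induction n with
  | zero =>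
    intro _
    exact ⟨fun _ => 1, rfl, by simp, by intro i hi; simp [Nat.le_zero.1 hi, wtw]⟩
  | succ n ih =>
    intro hn
    obtain ⟨W, h0, h1, h2⟩ := ih (by omega)
    let y : K := β * ∑ j ∈ Finset.range (n + 1), c n j • W j
    have hy : v y = γ ^ (q * wtw q m (n + 1)) := by
      rw [wtw_succ q m n (by omega), pow_add, map_mul, hβ]
      congr 1
      rw [Finset.sum_range_succ, ← h2 n le_rfl]
      have e1 : v (c n n • W n) = v (W n) := by
        rw [Algebra.smul_def, map_mul, hscal _ (hc n), one_mul]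
      rw [Valuation.map_add_eq_of_lt_right, e1]
      rw [e1]
      apply Valuation.map_sum_lt
      · rw [h2 n le_rfl]; exact (pow_pos hγ0 _).ne'
      · intro j hj
        rw [Finset.mem_range] at hj
        have e2 : v (c n j • W j) ≤ v (W j) := by
          by_cases hz : c n j = 0
          · simp [hz]
          · rw [Algebra.smul_def, map_mul, hscal _ hz, one_mul]
        refine e2.trans_lt ?_
        rw [h2 j hj.le, h2 n le_rfl]
        exact pow_lt_pow_right₀ hγ (wtw_lt q m n j hq (by omega) hj)
    obtain ⟨w, hw⟩ := IsAlgClosed.exists_root (X ^ q - X - C y : K[X]) (by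
      have : (X ^ q - X - C y : K[X]).degree = q := by
        rw [sub_sub]
        rw [Polynomial.degree_sub_eq_left_of_degree_lt]
        · simp
        · rw [degree_X_add_C, degree_X_pow]; exact_mod_cast hq
      rw [this]; exact_mod_cast (by omega : q ≠ 0))
    have hw : w ^ q = w + y := by
      simp [Polynomial.IsRoot] at hw
      linear_combination hw
    have hpos : 0 < q * wtw q m (n+1) := by
      rw [wtw_succ q m n (by omega)]; positivity
    have hy1 : 1 < v y := by rw [hy]; exact one_lt_pow₀ hγ hpos.ne'
    have hw1 : 1 < v w := by
      by_contra hle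
      push Not at hle
      have : y = w ^ q - w := by rw [hw]; ring
      have h3 : v y ≤ 1 := by
        rw [this]
        refine v.map_sub_le ?_ hle
        rw [map_pow]; exact pow_le_one₀ zero_le hle
      exact absurd h3 (not_le.2 hy1)
    have hvw : v w ^ q = v y := by
      have : y = w ^ q - w := by rw [hw]; ring
      rw [this, Valuation.map_sub_eq_of_lt_left, map_pow]
      rw [map_pow]
      calc v w = v w ^ 1 := (pow_one _).symm
        _ < v w ^ q := pow_lt_pow_right₀ hw1 (by omega)
    have hvw2 : v w = γ ^ wtw q m (n + 1) := by
      rw [hy, mul_comm, pow_mul] at hvw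
      exact (pow_left_inj₀ zero_le zero_le (by omega)).1 hvw
    refine ⟨Function.update W (n + 1) w, ?_, ?_, ?_⟩
    · rw [Function.update_of_ne (by omega)]; exact h0
    · intro i hi
      have hs : ∑ j ∈ Finset.range (i + 1), c i j • Function.update W (n + 1) w j =
          ∑ j ∈ Finset.range (i + 1), c i j • W j := by
        apply Finset.sum_congr rfl
        intro j hj
        rw [Finset.mem_range] at hj
        rw [Function.update_of_ne (by omega)]
      rw [hs]
      by_cases hin : i = n
      · subst hin
        rw [Function.update_self]; exact hw
      · rw [Function.update_of_ne (by omega)]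
        exact h1 i (by omega)
    · intro i hi
      by_cases hin : i = n + 1
      · subst hin; rw [Function.update_self]; exact hvw2
      · rw [Function.update_of_ne hin]; exact h2 i (by omega)

/-- extend a coordinate vector -/
def extW {E : Type*} [One E] [Zero E] (m : ℕ) (ω : Fin m → E) (j : ℕ) : E :=
  match j with
  | 0 => 1
  | j + 1 => if h : j < m then ω ⟨j, h⟩ else 0

theorem curve_bound (q m : ℕ) (hq : 2 ≤ q) (E : Type) [Field E] [Fintype E]
    (p e : ℕ) [Fact p.Prime] [CharP E p] (hE : Fintype.card E = p ^ e * p ^ e)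
    (ht : (gapB q m) ^ 2 + 3 * (gapB q m) + 1 < p ^ e)
    (c : ℕ → ℕ → E) (hc : ∀ i, c i i ≠ 0)
    (pts : Finset (E × (Fin m → E)))
    (hpts : ∀ P ∈ pts, ∀ i : Fin m, P.2 i ^ q = P.2 i + P.1 * ∑ j ∈ Finset.range (i + 1), c i j * extW m P.2 j) :
    pts.card ≤ p ^ e * p ^ e + (2 * gapB q m + 1) * p ^ e := by
  classical
  obtain ⟨K, _, _, _, Γ, _, v, z, hz⟩ := exists_valued E
  set γ := v z with hγdef
  have hscalK : ∀ a : E, a ≠ 0 → v (algebraMap E K a) = 1 := by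
    intro a ha
    have h1 : a ^ (Fintype.card E - 1) = 1 := FiniteField.pow_card_sub_one_eq_one a ha
    have h2 : v (algebraMap E K a) ^ (Fintype.card E - 1) = 1 := by
      rw [← map_pow, ← map_pow, h1, map_one, map_one]
    have : Fintype.card E - 1 ≠ 0 := by
      have := Fintype.one_lt_card (α := E); omega
    exact (pow_eq_one_iff_of_nonneg zero_le this).1 h2
  obtain ⟨WK, hK0, hK1, hK2⟩ := exists_W (E := E) v γ hz (z ^ (q ^ m)) q m hq (by rw [map_pow]) hscalK c hc m le_rfl
  -- the algebra
  let P := MvPolynomial (Option (Fin m)) E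
  let WP : ℕ → P := fun j => match j with
    | 0 => 1
    | j + 1 => if h : j < m then MvPolynomial.X (some ⟨j, h⟩) else 0
  let βP : P := MvPolynomial.X none
  let rel : Fin m → P := fun i => WP (i + 1) ^ q - (WP (i + 1) + βP * ∑ j ∈ Finset.range (i + 1), c i j • WP j)
  let I : Ideal P := Ideal.span (Set.range rel)
  let A := P ⧸ I
  let W : ℕ → A := fun j => Ideal.Quotient.mkₐ E I (WP j)
  let β : A := Ideal.Quotient.mkₐ E I βP
  have hW0 : W 0 = 1 := by simp [W, WP]
  have hrel : ∀ i < m, W (i + 1) ^ q = W (i + 1) + β * ∑ j ∈ Finset.range (i + 1), c i j • W j := by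
    intro i hi
    have : Ideal.Quotient.mkₐ E I (rel ⟨i, hi⟩) = 0 := by
      rw [Ideal.Quotient.mkₐ_eq_mk, Ideal.Quotient.eq_zero_iff_mem]
      exact Ideal.subset_span ⟨_, rfl⟩
    simp only [rel, map_sub, map_add, map_mul, map_pow, map_sum, map_smul] at this
    exact sub_eq_zero.1 this
  have hspan : ∀ x : A, x ∈ nspan E q m β W := by
    intro x
    obtain ⟨f, rfl⟩ := Ideal.Quotient.mkₐ_surjective E I x
    induction f using MvPolynomial.induction_on with
    | C a =>
      have h1 : (1 : A) ∈ nspan E q m β W := by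
        have := mon_mem q m β W hq hW0 c hrel 0 0 (fun _ => 0) (by simp)
        simpa [mon] using this
      have h2 : Ideal.Quotient.mkₐ E I (MvPolynomial.C a) = a • (1 : A) := by
        rw [← MvPolynomial.algebraMap_eq, AlgHom.commutes, Algebra.algebraMap_eq_smul_one]
      rw [h2]
      exact Submodule.smul_mem _ _ h1
    | add f g hf hg => rw [map_add]; exact Submodule.add_mem _ hf hg
    | mul_X f i hf =>
      have := nspan_mul q m β W hq hW0 c hrel _ hf
      rw [map_mul, mul_comm]
      rcases i with _ | i
      · exact this.1
      · have h3 := this.2 i i.2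
        simpa [W, WP] using h3
  -- generic hom
  have hom : ∀ (B : Type) [CommRing B] [Algebra E B] (b : B) (ω : ℕ → B), ω 0 = 1 →
      (∀ i < m, ω (i + 1) ^ q = ω (i + 1) + b * ∑ j ∈ Finset.range (i + 1), c i j • ω j) →
      ∃ φ : A →ₐ[E] B, φ β = b ∧ ∀ j ≤ m, φ (W j) = ω j := by
    intro B _ _ b ω hω0 hω
    let φP : P →ₐ[E] B := MvPolynomial.aeval (fun o => match o with
      | none => b
      | some i => ω (i.1 + 1))
    have hφW : ∀ j ≤ m, φP (WP j) = ω j := by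
      intro j hj
      rcases j with _ | j
      · simp [WP, hω0]
      · have : j < m := hj
        have e : WP (j + 1) = MvPolynomial.X (some ⟨j, this⟩) := dif_pos this
        rw [e]
        exact MvPolynomial.aeval_X _ _
    have hker : ∀ a ∈ I, φP a = 0 := by
      intro a ha
      have : I ≤ RingHom.ker φP := by
        rw [Ideal.span_le]
        rintro _ ⟨i, rfl⟩
        simp only [SetLike.mem_coe, RingHom.mem_ker, rel, map_sub, map_add, map_mul, map_pow, map_sum, map_smul]
        rw [hφW _ i.2, hω i i.2, sub_eq_zero]
        have : φP βP = b := MvPolynomial.aeval_X _ _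
        rw [this]
        congr 2
        apply Finset.sum_congr rfl
        intro j hj
        rw [Finset.mem_range] at hj
        rw [hφW j (by omega)]
      exact this ha
    refine ⟨Ideal.Quotient.liftₐ I φP hker, ?_, ?_⟩
    · change φP βP = b
      exact MvPolynomial.aeval_X _ _
    · intro j hj
      exact hφW j hj
  obtain ⟨ψ, hψβ, hψW⟩ := hom K (z ^ (q ^ m)) WK hK0 hK1
  let vA : Valuation A Γ := v.comap (ψ : A →+* K)
  have hvA : ∀ x, vA x = v (ψ x) := fun x => rfl
  let nm : ℕ × (Fin m → Fin q) → A := fun x => mon m β W x.1 (fun i => (x.2 i : ℕ))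
  have hnm : ∀ x, vA (nm x) = γ ^ wtN q m x := by
    intro x
    rw [hvA]
    simp only [nm, mon, map_mul, map_pow, map_prod, hψβ]
    rw [wtN, pow_add, ← hγdef, ← pow_mul, mul_comm x.1, ← Finset.prod_pow_eq_pow_sum]
    congr 1
    apply Finset.prod_congr rfl
    intro i _
    rw [hψW _ i.2, hK2 _ i.2, ← pow_mul, mul_comm]
  have : Nonempty (ℕ × (Fin m → Fin q)) := ⟨(0, fun _ => ⟨0, by omega⟩)⟩
  let inv : ℕ → ℕ × (Fin m → Fin q) := Function.invFun (wtN q m)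
  have hinv : ∀ x, inv (wtN q m x) = x := Function.leftInverse_invFun (wtN_inj q m hq)
  have H : OnePt E vA γ (Set.range (wtN q m)) (fun n => nm (inv n)) := by
    refine ⟨hz, ?_, ?_, ?_⟩
    · rintro _ ⟨x, rfl⟩
      rw [hinv, hnm]
    · intro x
      have hx := hspan x
      unfold nspan at hx
      rw [Finsupp.mem_span_range_iff_exists_finsupp] at hx
      obtain ⟨cf, hcf⟩ := hx
      refine ⟨cf.support.image (wtN q m), fun n => cf (inv n), ?_, ?_⟩
      · intro i hi
        rw [Finset.mem_image] at hi
        obtain ⟨a, _, rfl⟩ := hi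
        exact ⟨a, rfl⟩
      · rw [Finset.sum_image (fun a _ b _ h => wtN_inj q m hq h)]
        simp only [hinv]
        exact hcf.symm
    · intro a ha
      rw [hvA, AlgHom.commutes]
      exact hscalK a ha
  -- points
  have hφ : ∀ Q : pts, ∃ φ : A →ₐ[E] E, φ β = Q.1.1 ∧ ∀ j ≤ m, φ (W j) = extW m Q.1.2 j := by
    intro Q
    apply hom E Q.1.1 (extW m Q.1.2) rfl
    intro i hi
    have := hpts Q.1 Q.2 ⟨i, hi⟩
    simp only [smul_eq_mul]
    simpa [extW, hi] using this
  choose φ hφ1 hφ2 using hφ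
  have hφinj : Function.Injective φ := by
    intro Q Q' h
    apply Subtype.ext
    apply Prod.ext
    · rw [← hφ1, ← hφ1, h]
    · funext i
      have e1 := hφ2 Q (i + 1) i.2
      have e2 := hφ2 Q' (i + 1) i.2
      rw [h, e2] at e1
      simpa [extW] using e1.symm
  have := H.bombieri (gapB q m) (wtN_cofinite q m hq) p e hE ht (Finset.univ.image φ)
  rw [Finset.card_image_of_injective _ hφinj] at this
  simpa using this

end Curve

end Part2

section Part3

/-- Truncated one-units. -/
def TG (m : ℕ) (E : Type*) : Type _ := Fin m → E

namespace TG
open PowerSeries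

section
variable {m : ℕ} {E : Type*} [Field E]

noncomputable instance [Fintype E] : Fintype (TG m E) := by
  classical exact inferInstanceAs (Fintype (Fin m → E))
noncomputable instance : DecidableEq (TG m E) := Classical.decEq _

theorem card_eq [Fintype E] : Fintype.card (TG m E) = Fintype.card E ^ m := by
  classical
  change Fintype.card (Fin m → E) = _
  simp

/-- truncation of a power series -/
noncomputable def tr (m : ℕ) (f : E⟦X⟧) : TG m E := fun i => coeff (i.1 + 1) f

/-- lift to a power series -/
noncomputable def ps (w : TG m E) : E⟦X⟧ := PowerSeries.mk (fun n => extW m w n)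

theorem coeff_ps (w : TG m E) (n : ℕ) : coeff n (ps w) = extW m w n := by simp [ps]

theorem ps_zero (w : TG m E) : coeff 0 (ps w) = 1 := by simp [ps, extW]

theorem tr_ps (w : TG m E) : tr m (ps w) = w := by
  funext i
  simp [tr, coeff_ps, extW]

/-- agreement up to degree `m` -/
def Agree (m : ℕ) (f g : E⟦X⟧) : Prop := ∀ i ≤ m, coeff i f = coeff i g

theorem Agree.mul {f g f' g' : E⟦X⟧} (h : Agree m f g) (h' : Agree m f' g') :
    Agree m (f * f') (g * g') := by
  intro i hi
  rw [coeff_mul, coeff_mul]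
  apply Finset.sum_congr rfl
  rintro ⟨a, b⟩ hab
  rw [Finset.HasAntidiagonal.mem_antidiagonal] at hab
  simp only at hab ⊢
  rw [h a (by omega), h' b (by omega)]

theorem Agree.symm {f g : E⟦X⟧} (h : Agree m f g) : Agree m g f := fun i hi => (h i hi).symm
theorem Agree.rfl {f : E⟦X⟧} : Agree m f f := fun _ _ => by rfl
theorem Agree.trans {f g k : E⟦X⟧} (h : Agree m f g) (h' : Agree m g k) : Agree m f k :=
  fun i hi => (h i hi).trans (h' i hi)

theorem tr_eq_iff {f g : E⟦X⟧} (hf : coeff 0 f = 1) (hg : coeff 0 g = 1) :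
    tr m f = tr m g ↔ Agree m f g := by
  constructor
  · intro h i hi
    rcases i with _ | i
    · rw [hf, hg]
    · exact congrFun h ⟨i, hi⟩
  · intro h
    funext i
    exact h (i.1 + 1) i.2

theorem agree_ps_tr {f : E⟦X⟧} (hf : coeff 0 f = 1) : Agree m (ps (tr m f)) f := by
  rw [← tr_eq_iff (ps_zero _) hf, tr_ps]

theorem coeff0_mul {f g : E⟦X⟧} (hf : coeff 0 f = 1) (hg : coeff 0 g = 1) : coeff 0 (f * g) = 1 := by
  rw [coeff_zero_eq_constantCoeff] at *
  rw [map_mul, hf, hg, one_mul]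

theorem coeff0_inv {f : E⟦X⟧} (hf : coeff 0 f = 1) : coeff 0 (f⁻¹) = 1 := by
  rw [coeff_zero_eq_constantCoeff] at *
  rw [PowerSeries.constantCoeff_inv, hf, inv_one]

noncomputable instance : Mul (TG m E) := ⟨fun a b => tr m (ps a * ps b)⟩
noncomputable instance : One (TG m E) := ⟨tr m 1⟩
noncomputable instance : Inv (TG m E) := ⟨fun a => tr m (ps a)⁻¹⟩

theorem mul_def (a b : TG m E) : a * b = tr m (ps a * ps b) := rfl

theorem tr_one : tr m (1 : E⟦X⟧) = 1 := rfl

theorem tr_mul {f g : E⟦X⟧} (hf : coeff 0 f = 1) (hg : coeff 0 g = 1) :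
    tr m (f * g) = tr m f * tr m g := by
  rw [mul_def, tr_eq_iff (coeff0_mul hf hg) (coeff0_mul (ps_zero _) (ps_zero _))]
  exact ((agree_ps_tr hf).mul (agree_ps_tr hg)).symm

noncomputable instance : CommGroup (TG m E) where
  mul_assoc a b c := by
    rw [← tr_ps a, ← tr_ps b, ← tr_ps c, ← tr_mul, ← tr_mul, ← tr_mul, ← tr_mul, mul_assoc] <;>
      simp only [ps_zero, coeff0_mul]
  one_mul a := by
    rw [← tr_ps a, ← tr_one, ← tr_mul (by simp) (ps_zero _), one_mul]
  mul_one a := by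
    rw [← tr_ps a, ← tr_one, ← tr_mul (ps_zero _) (by simp), mul_one]
  mul_comm a b := by rw [mul_def, mul_def, mul_comm]
  inv_mul_cancel a := by
    have h : a⁻¹ * tr m (ps a) = 1 := by
      change tr m (ps a)⁻¹ * tr m (ps a) = 1
      rw [← tr_mul (coeff0_inv (ps_zero _)) (ps_zero _), PowerSeries.inv_mul_cancel, tr_one]
      have := ps_zero a
      rw [coeff_zero_eq_constantCoeff] at this
      rw [this]; exact one_ne_zero
    rw [tr_ps] at h
    exact h

theorem tr_prod {ι : Type*} (s : Finset ι) (f : ι → E⟦X⟧) (hf : ∀ i ∈ s, coeff 0 (f i) = 1) :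
    coeff 0 (∏ i ∈ s, f i) = 1 ∧ tr m (∏ i ∈ s, f i) = ∏ i ∈ s, tr m (f i) := by
  classical
  induction s using Finset.induction_on with
  | empty => simp [tr_one]
  | insert a s ha ih =>
    have h1 := ih (fun i hi => hf i (Finset.mem_insert_of_mem hi))
    have h2 := hf a (Finset.mem_insert_self _ _)
    rw [Finset.prod_insert ha, Finset.prod_insert ha]
    exact ⟨coeff0_mul h2 h1.1, by rw [tr_mul h2 h1.1, h1.2]⟩

end

section
variable {m : ℕ} {E E' : Type*} [Field E] [Field E']

/-- functoriality -/
def mpf (φ : E →+* E') (w : TG m E) : TG m E' := fun i => φ (w i)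

theorem ps_mpf (φ : E →+* E') (w : TG m E) : ps (mpf φ w) = PowerSeries.map φ (ps w) := by
  ext n
  rw [coeff_ps, coeff_map, coeff_ps]
  rcases n with _ | n
  · simp [extW]
  · simp only [extW]
    split_ifs
    · rfl
    · simp

theorem mpf_tr (φ : E →+* E') (f : E⟦X⟧) : mpf φ (tr m f) = tr m (PowerSeries.map φ f) := by
  funext i
  simp [mpf, tr]

/-- functoriality -/
noncomputable def mp (φ : E →+* E') : TG m E →* TG m E' where
  toFun w := mpf φ w
  map_one' := by rw [← tr_one, ← tr_one, mpf_tr, map_one]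
  map_mul' a b := by
    rw [mul_def, mul_def, mpf_tr, map_mul, ps_mpf, ps_mpf]

theorem mp_apply (φ : E →+* E') (w : TG m E) (i : Fin m) : mp φ w i = φ (w i) := rfl

theorem mp_tr (φ : E →+* E') (f : E⟦X⟧) : mp φ (tr m f) = tr m (PowerSeries.map φ f) := mpf_tr φ f

theorem ps_mp (φ : E →+* E') (w : TG m E) : ps (mp φ w) = PowerSeries.map φ (ps w) := ps_mpf φ w

theorem mp_inj (φ : E →+* E') : Function.Injective (mp (m := m) φ) := by
  intro a b h
  funext i
  exact φ.injective (congrFun h i)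

/-- the linear one-unit -/
noncomputable def lin (m : ℕ) (a : E) : TG m E := tr m (1 - PowerSeries.C a * X)

theorem lin0 (a : E) : coeff 0 (1 - PowerSeries.C a * X : E⟦X⟧) = 1 := by simp

end
end TG

end Part3

section Part4

namespace TG
open PowerSeries

theorem lin_rel {m : ℕ} {E : Type*} [Field E] (q : ℕ) (fr : E →+* E) (hfr : ∀ x, fr x = x ^ q)
    (a a0 : E) (w : TG m E) (h : mp fr w * lin m a0 = lin m a * w) (i : Fin m) :
    w i ^ q = w i + (a - a0) * ∑ j ∈ Finset.range (i + 1), (- a0 ^ (i - j : ℕ)) * extW m w j := by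
  let Gs : E⟦X⟧ := PowerSeries.mk (fun n => a0 ^ n)
  have hG : (1 - PowerSeries.C a0 * X) * Gs = 1 := by
    ext n
    rcases n with _ | n
    · simp [Gs]
    · rw [sub_mul, one_mul, map_sub, mul_assoc, coeff_C_mul, coeff_succ_X_mul]
      simp [Gs, pow_succ', PowerSeries.coeff_one]
  have h1 : Agree m (ps (mp fr w) * (1 - PowerSeries.C a0 * X)) ((1 - PowerSeries.C a * X) * ps w) := by
    rw [← tr_eq_iff (coeff0_mul (ps_zero _) (lin0 _)) (coeff0_mul (lin0 _) (ps_zero _)),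
      tr_mul (ps_zero _) (lin0 _), tr_mul (lin0 _) (ps_zero _), tr_ps, tr_ps]
    exact h
  have h2 := h1.mul (Agree.rfl (f := Gs)) (i.1 + 1) i.2
  have e1 : (ps (mp fr w) * (1 - PowerSeries.C a0 * X)) * Gs = ps (mp fr w) := by
    rw [mul_assoc, hG, mul_one]
  have e2 : ((1 - PowerSeries.C a * X) * ps w) * Gs = ps w - PowerSeries.C (a - a0) * (X * (ps w * Gs)) := by
    have : (1 - PowerSeries.C a * X : E⟦X⟧) = (1 - PowerSeries.C a0 * X) - PowerSeries.C (a - a0) * X := by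
      rw [map_sub]; ring
    rw [this]
    linear_combination (ps w) * hG
  rw [e1, e2, map_sub, coeff_C_mul, coeff_succ_X_mul, coeff_ps, coeff_ps, coeff_mul,
    Finset.Nat.sum_antidiagonal_eq_sum_range_succ (fun x y => coeff x (ps w) * coeff y Gs)] at h2
  simp only [extW, i.2, dif_pos, Fin.eta, mp_apply, hfr, coeff_ps] at h2
  rw [h2, sub_eq_add_neg, ← mul_neg, ← Finset.sum_neg_distrib]
  congr 2
  apply Finset.sum_congr rfl
  intro j _
  simp only [Gs, coeff_mk, extW]
  ring

theorem weil_E (q m : ℕ) (hq : 2 ≤ q) (E : Type) [Field E] [Fintype E]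
    (p e : ℕ) [Fact p.Prime] [CharP E p] (hE : Fintype.card E = p ^ e * p ^ e)
    (ht : gapB q m ^ 2 + 3 * gapB q m + 1 < p ^ e)
    (fr : E →+* E) (hfr : ∀ x, fr x = x ^ q)
    (Θ : TG m E →* ℂ) (hΘ : ∀ w, Θ (mp fr w) = Θ w) (hne : Θ ≠ 1) :
    ‖∑ a : E, Θ (lin m a)‖ ≤ (2 * gapB q m + 1 : ℕ) * (p : ℝ) ^ e := by
  classical
  let T : TG m E → Finset (E × TG m E) := fun g =>
    Finset.univ.filter (fun x => mp fr x.2 * g = lin m x.1 * x.2)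
  set B : ℕ := p ^ e * p ^ e + (2 * gapB q m + 1) * p ^ e with hB
  have hT : ∀ g, (T g).card ≤ B := by
    intro g
    rcases (T g).eq_empty_or_nonempty with h | ⟨⟨a0, w0⟩, h0⟩
    · rw [h]; simp
    simp only [T, Finset.mem_filter, Finset.mem_univ, true_and] at h0
    let ff : E × TG m E → E × (Fin m → E) := fun x => (x.1 - a0, (x.2 * w0⁻¹ : TG m E))
    have hinj : Function.Injective ff := by
      rintro ⟨a, w⟩ ⟨a', w'⟩ h
      have h1 : a - a0 = a' - a0 := congrArg Prod.fst h
      have h2 : (w * w0⁻¹ : TG m E) = w' * w0⁻¹ := congrArg Prod.snd h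
      rw [sub_left_inj] at h1
      rw [h1, mul_right_cancel h2]
    rw [← Finset.card_image_of_injective _ hinj]
    refine curve_bound q m hq E p e hE ht (fun i j => - a0 ^ (i - j)) (by simp) _ ?_
    intro P hP i
    rw [Finset.mem_image] at hP
    obtain ⟨⟨a, w⟩, hx, rfl⟩ := hP
    simp only [T, Finset.mem_filter, Finset.mem_univ, true_and] at hx
    have := lin_rel q fr hfr a a0 (w * w0⁻¹) (by
      rw [map_mul, map_inv]
      have e1 : lin m a0 = mp fr w0 * g * w0⁻¹ := by rw [h0]; group
      rw [e1, ← mul_assoc (lin m a), ← hx]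
      rw [mul_comm (mp fr w0) g]
      have : ∀ A B g w : TG m E, A * B⁻¹ * (g * B * w) = A * g * w := by
        intro A B g w
        rw [mul_comm g B, mul_assoc, mul_assoc B, inv_mul_cancel_left, mul_assoc]
      exact this _ _ _ _) i
    exact this
  have hnorm : ∀ g, ‖Θ g‖ = 1 := by
    intro g
    apply Complex.norm_eq_one_of_pow_eq_one (n := Fintype.card (TG m E))
    · rw [← map_pow, pow_card_eq_one, map_one]
    · exact Fintype.card_ne_zero
  have hsum0 : ∑ g, Θ g = 0 := sum_hom_units_eq_zero Θ hne
  have key : ∀ (φ : TG m E → ℂ), ∑ g, φ g * ((T g).card : ℂ) =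
      ∑ x : E × TG m E, φ (lin m x.1 * x.2 * (mp fr x.2)⁻¹) := by
    intro φ
    have : ∀ g, φ g * ((T g).card : ℂ) = ∑ x : E × TG m E, if g = lin m x.1 * x.2 * (mp fr x.2)⁻¹ then φ g else 0 := by
      intro g
      rw [Finset.sum_ite, Finset.sum_const_zero, add_zero, Finset.sum_const, nsmul_eq_mul, mul_comm]
      congr 3
      ext x
      simp only [T, Finset.mem_filter, Finset.mem_univ, true_and]
      rw [_root_.eq_mul_inv_iff_mul_eq, mul_comm]
    simp only [this]
    rw [Finset.sum_comm]
    simp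
  have k1 : ∑ g, Θ g * ((T g).card : ℂ) = Fintype.card (TG m E) * ∑ a : E, Θ (lin m a) := by
    rw [key, Fintype.sum_prod_type]
    have : ∀ a w, Θ (lin m a * w * (mp fr w)⁻¹) = Θ (lin m a) := by
      intro a w
      have h1 : Θ (mp fr w)⁻¹ * Θ (mp fr w) = 1 := by rw [← map_mul]; simp
      rw [hΘ] at h1
      rw [map_mul, map_mul, mul_assoc, mul_comm (Θ w), h1, mul_one]
    simp only [this, Finset.sum_const, Finset.card_univ, nsmul_eq_mul, Finset.mul_sum]
  have k2 : ∑ g, ((T g).card : ℂ) = Fintype.card (TG m E) * Fintype.card E := by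
    have := key (fun _ => 1)
    simp only [one_mul, Finset.sum_const, Finset.card_univ, nsmul_eq_mul, mul_one, Fintype.card_prod] at this
    rw [this]; push_cast; ring
  have k2' : ∑ g, ((T g).card : ℝ) = Fintype.card (TG m E) * Fintype.card E := by
    exact_mod_cast k2
  have k3 : (Fintype.card (TG m E) : ℝ) * ‖∑ a : E, Θ (lin m a)‖ ≤
      Fintype.card (TG m E) * (B - Fintype.card E) := by
    have e1 : (Fintype.card (TG m E) : ℝ) * ‖∑ a : E, Θ (lin m a)‖ =
        ‖∑ g, Θ g * (((T g).card : ℂ) - B)‖ := by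
      simp only [mul_sub, Finset.sum_sub_distrib]
      rw [k1, ← Finset.sum_mul, hsum0, zero_mul, sub_zero, norm_mul]
      simp
    rw [e1]
    refine (norm_sum_le _ _).trans ?_
    have e2 : ∀ g, ‖Θ g * (((T g).card : ℂ) - B)‖ = (B : ℝ) - (T g).card := by
      intro g
      rw [norm_mul, hnorm, one_mul, norm_sub_rev]
      have : ((B : ℂ) - (T g).card) = ((B - (T g).card : ℕ) : ℂ) := by
        rw [Nat.cast_sub (hT g)]
      rw [this, Complex.norm_natCast, Nat.cast_sub (hT g)]
    simp only [e2, Finset.sum_sub_distrib, k2', Finset.sum_const, Finset.card_univ, nsmul_eq_mul]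
    apply le_of_eq; ring
  have hpos : (0 : ℝ) < Fintype.card (TG m E) := by exact_mod_cast Fintype.card_pos
  have k4 := le_of_mul_le_mul_left k3 hpos
  refine k4.trans (le_of_eq ?_)
  rw [hB, hE]; push_cast; ring

end TG

end Part4

section Part5

namespace TG
open PowerSeries

theorem prod_one_add {E ι : Type*} [Field E] (s : Finset ι) (y : ι → E) (k : ℕ) :
    ∃ R : E⟦X⟧, ∏ i ∈ s, (1 + PowerSeries.C (y i) * X ^ (k + 1)) =
      1 + PowerSeries.C (∑ i ∈ s, y i) * X ^ (k + 1) + X ^ (k + 2) * R := by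
  classical
  induction s using Finset.induction_on with
  | empty => exact ⟨0, by simp⟩
  | insert a s ha ih =>
    obtain ⟨R, hR⟩ := ih
    rw [Finset.prod_insert ha, Finset.sum_insert ha, hR]
    refine ⟨R + PowerSeries.C (y a) * PowerSeries.C (∑ i ∈ s, y i) * X ^ k + PowerSeries.C (y a) * X ^ (k + 1) * R, ?_⟩
    rw [map_add]
    ring

theorem inv_def {m : ℕ} {E : Type*} [Field E] (u : TG m E) : u⁻¹ = tr m (ps u)⁻¹ := rfl

theorem div_zero_of_agree {m : ℕ} {E : Type*} [Field E] (g u : TG m E) (i0 : ℕ)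
    (h : ∀ i : Fin m, i.1 ≤ i0 → g i = u i) (i : Fin m) (hi : i.1 ≤ i0) : (g * u⁻¹) i = 0 := by
  have h1 : Agree (i0 + 1) (ps g) (ps u) := by
    intro j hj
    rw [coeff_ps, coeff_ps]
    rcases j with _ | j
    · rfl
    · simp only [extW]
      split_ifs with hjm
      · exact h ⟨j, hjm⟩ (by simpa using hj)
      · rfl
  have h2 := (h1.mul (Agree.rfl (f := (ps u)⁻¹))) (i.1 + 1) (by omega)
  have h3 : g * u⁻¹ = tr m (ps g * (ps u)⁻¹) := by
    rw [tr_mul (ps_zero _) (coeff0_inv (ps_zero _)), tr_ps, inv_def]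
  rw [h3]
  change coeff (i.1 + 1) _ = 0
  rw [h2, PowerSeries.mul_inv_cancel, PowerSeries.coeff_one]
  · simp
  · have := ps_zero u
    rw [coeff_zero_eq_constantCoeff] at this
    rw [this]; exact one_ne_zero

theorem exists_norm (m : ℕ) (F E : Type*) [Field F] [Field E] [Algebra F E] [FiniteDimensional F E]
    [IsGalois F E] :
    ∃ N : TG m E →* TG m F, (∀ v, mp (algebraMap F E) (N v) =
      ∏ σ : E ≃ₐ[F] E, mp (σ : E →+* E) v) ∧ Function.Surjective N := by
  classical
  let ι : TG m F →* TG m E := mp (algebraMap F E)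
  have hι : Function.Injective ι := mp_inj _
  let P : TG m E →* TG m E := ∏ σ : E ≃ₐ[F] E, mp (σ : E →+* E)
  have hPv : ∀ v, P v = ∏ σ : E ≃ₐ[F] E, mp (σ : E →+* E) v := fun v => by
    simp only [P, MonoidHom.finsetProd_apply]
  have hP : ∀ v, P v ∈ ι.range := by
    intro v
    have hfix : ∀ τ : E ≃ₐ[F] E, mp (τ : E →+* E) (P v) = P v := by
      intro τ
      rw [hPv, map_prod]
      rw [← Equiv.prod_comp (Equiv.mulLeft τ) (fun σ : E ≃ₐ[F] E => mp (σ : E →+* E) v)]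
      rfl
    have : ∀ i : Fin m, ∃ c : F, algebraMap F E c = P v i := by
      intro i
      have := (IsGalois.mem_bot_iff_fixed (F := F) (E := E) (P v i)).2 (fun τ => congrFun (hfix τ) i)
      rwa [IntermediateField.mem_bot] at this
    choose c hc using this
    exact ⟨c, funext hc⟩
  let e := MonoidHom.ofInjective hι
  let N : TG m E →* TG m F := e.symm.toMonoidHom.comp (P.codRestrict ι.range hP)
  have hN : ∀ v, ι (N v) = P v := by
    intro v
    have : e (N v) = P.codRestrict ι.range hP v := by simp [N]
    exact congrArg Subtype.val this
  refine ⟨N, fun v => (hN v).trans (hPv v), ?_⟩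
  have claim : ∀ d : ℕ, ∀ g : TG m F, (∀ i : Fin m, i.1 + d < m → g i = 0) → g ∈ N.range := by
    intro d
    induction d with
    | zero =>
      intro g hg
      have : g = 1 := by
        funext i
        rw [hg i i.2, ← tr_one]
        change 0 = coeff (i.1 + 1) (1 : F⟦X⟧)
        rw [PowerSeries.coeff_one]; simp
      rw [this]; exact N.range.one_mem
    | succ d ih =>
      intro g hg
      by_cases hd : m ≤ d
      · exact ih g (fun i hi => by omega)
      push Not at hd
      let i0 : Fin m := ⟨m - 1 - d, by omega⟩
      obtain ⟨c, hc⟩ := Algebra.trace_surjective F E (g i0)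
      let v : TG m E := tr m (1 + PowerSeries.C c * X ^ (i0.1 + 1))
      have hu : ∀ i : Fin m, i.1 ≤ i0.1 → g i = N v i := by
        intro i hi
        apply (algebraMap F E).injective
        have h1 : algebraMap F E (N v i) = P v i := congrFun (hN v) i
        rw [h1, hPv]
        simp only [v, mp_tr]
        rw [← (tr_prod _ _ (fun σ _ => by simp)).2]
        change _ = coeff (i.1 + 1) _
        simp only [map_add, map_one, map_mul, map_pow, map_C, map_X]
        obtain ⟨R, hR⟩ := prod_one_add (Finset.univ : Finset (E ≃ₐ[F] E)) (fun σ => σ c) i0.1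
        have h2 := congrArg (coeff (i.1 + 1)) hR
        refine Eq.trans ?_ h2.symm
        rw [map_add, map_add, coeff_C_mul, coeff_X_pow, coeff_X_pow_mul', if_neg (show ¬ (i0.1 + 2 ≤ i.1 + 1) by omega),
          ← trace_eq_sum_automorphisms, hc, PowerSeries.coeff_one, if_neg (show ¬ (i.1 + 1 = 0) by omega)]
        by_cases hii : i = i0
        · subst hii; simp
        · have : i.1 < i0.1 := lt_of_le_of_ne hi (fun h => hii (Fin.ext h))
          rw [if_neg (by omega), hg i (by simp only [i0] at this; omega)]; simp
      have := ih (g * (N v)⁻¹) (fun i hi => div_zero_of_agree g (N v) i0.1 hu i (by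
        simp only [i0]; omega))
      have h3 : g = g * (N v)⁻¹ * N v := by group
      rw [h3]
      exact N.range.mul_mem this ⟨v, rfl⟩
  intro g
  exact claim m g (fun i hi => by omega)

end TG

end Part5

section Part6
open Polynomial

theorem eq_pow_of_roots {F E : Type*} [Field F] [Field E] [Algebra F E] (P : F[X]) (hP : Irreducible P)
    (hm : P.Monic) : ∀ (n : ℕ) (G : F[X]), G.natDegree ≤ n → G.Monic → (G.map (algebraMap F E)).Splits →
    (∀ x : E, aeval x G = 0 → aeval x P = 0) → ∃ k, G = P ^ k := by
  intro n
  induction n with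
  | zero =>
    intro G hG hGm _ _
    exact ⟨0, by rw [pow_zero]; exact hGm.natDegree_eq_zero.1 (by omega)⟩
  | succ n ih =>
    intro G hG hGm hs hr
    by_cases h0 : G.natDegree = 0
    · exact ⟨0, by rw [pow_zero]; exact hGm.natDegree_eq_zero.1 h0⟩
    have hd : (G.map (algebraMap F E)).degree ≠ 0 := by
      rw [degree_map]
      intro h
      exact h0 (natDegree_eq_zero_iff_degree_le_zero.2 h.le)
    obtain ⟨x, hx⟩ := hs.exists_eval_eq_zero hd
    have hx' : aeval x G = 0 := by rwa [eval_map_algebraMap] at hx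
    have hPx := hr x hx'
    have hmin : P = minpoly F x := minpoly.eq_of_irreducible_of_monic hP hPx hm
    obtain ⟨G', hG'⟩ : P ∣ G := by rw [hmin]; exact minpoly.dvd _ _ hx'
    have hG'm : G'.Monic := by
      rw [hG'] at hGm
      exact hm.of_mul_monic_left hGm
    have hdeg : G.natDegree = P.natDegree + G'.natDegree := by rw [hG', hm.natDegree_mul hG'm]
    have hPpos := hP.natDegree_pos
    obtain ⟨k, hk⟩ := ih G' (by omega) hG'm (by
      apply Splits.of_dvd hs (hGm.map _).ne_zero
      rw [hG', Polynomial.map_mul]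
      exact dvd_mul_left _ _) (fun y hy => hr y (by rw [hG', map_mul, hy, mul_zero]))
    exact ⟨k + 1, by rw [hG', hk, pow_succ']⟩

theorem exists_cp (F : Type*) {E : Type*} [Field F] [Field E] [Algebra F E] [FiniteDimensional F E]
    [IsGalois F E] (a : E) : ∃ k, ((minpoly F a) ^ k).map (algebraMap F E) =
      ∏ σ : E ≃ₐ[F] E, (X - C (σ a)) ∧ k * (minpoly F a).natDegree = Module.finrank F E := by
  classical
  set g : E[X] := ∏ σ : E ≃ₐ[F] E, (X - C (σ a)) with hg
  have hgm : g.Monic := monic_prod_of_monic _ _ (fun σ _ => monic_X_sub_C _)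
  have hgd : g.natDegree = Module.finrank F E := by
    rw [hg, natDegree_prod_of_monic _ _ (fun σ _ => monic_X_sub_C _)]
    simp only [natDegree_X_sub_C, Finset.sum_const, Finset.card_univ, smul_eq_mul, mul_one]
    rw [← Nat.card_eq_fintype_card, IsGalois.card_aut_eq_finrank]
  have hfix : ∀ τ : E ≃ₐ[F] E, g.map (τ : E →+* E) = g := by
    intro τ
    rw [hg, Polynomial.map_prod]
    rw [← Equiv.prod_comp (Equiv.mulLeft τ) (fun σ : E ≃ₐ[F] E => (X - C (σ a)))]
    apply Finset.prod_congr rfl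
    intro σ _
    simp
  have hlift : g ∈ Polynomial.lifts (algebraMap F E) := by
    rw [Polynomial.lifts_iff_coeff_lifts]
    intro n
    have := (IsGalois.mem_bot_iff_fixed (F := F) (E := E) (g.coeff n)).2 (fun τ => by
      conv_rhs => rw [← hfix τ]
      rw [coeff_map]; rfl)
    rwa [IntermediateField.mem_bot] at this
  obtain ⟨G, hGmap, hGdeg, hGm⟩ := lifts_and_natDegree_eq_and_monic hlift hgm
  have hint : IsIntegral F a := Algebra.IsIntegral.isIntegral a
  obtain ⟨k, hk⟩ := eq_pow_of_roots (E := E) (minpoly F a) (minpoly.irreducible hint) (minpoly.monic hint) _ G le_rfl hGm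
    (by rw [hGmap]; exact Splits.prod (fun σ _ => Splits.X_sub_C _)) (by
      intro x hx
      rw [← eval_map_algebraMap, hGmap, hg, eval_prod, Finset.prod_eq_zero_iff] at hx
      obtain ⟨σ, _, hσ⟩ := hx
      rw [eval_sub, eval_X, eval_C, sub_eq_zero] at hσ
      rw [hσ, aeval_algHom_apply, minpoly.aeval, map_zero])
  refine ⟨k, by rw [← hk, hGmap], ?_⟩
  rw [← natDegree_pow, ← hk, hGdeg, hgd]

theorem reverse_lin {E : Type*} [Field E] (b : E) : (X - C b).reverse = 1 - C b * X := by
  ext n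
  rw [coeff_reverse, natDegree_X_sub_C]
  rcases n with _ | _ | n
  · rw [revAt_le (by omega)]; simp
  · rw [revAt_le (by omega)]; simp [coeff_one]
  · rw [revAt_eq_self_of_lt (by omega)]
    simp [coeff_X, coeff_one, coeff_C]

theorem reverse_prod_lin {E ι : Type*} [Field E] (s : Finset ι) (b : ι → E) :
    (∏ i ∈ s, (X - C (b i))).reverse = ∏ i ∈ s, (1 - C (b i) * X) := by
  classical
  induction s using Finset.induction_on with
  | empty => simpa using reverse_C (1 : E)
  | insert a s ha ih => rw [Finset.prod_insert ha, Finset.prod_insert ha, reverse_mul_of_domain, ih, reverse_lin]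

namespace TG

/-- the norm -/
noncomputable def nrm (m : ℕ) (F E : Type*) [Field F] [Field E] [Algebra F E] [FiniteDimensional F E]
    [IsGalois F E] : TG m E →* TG m F := (exists_norm m F E).choose

section
variable {m : ℕ} {F E : Type*} [Field F] [Field E] [Algebra F E] [FiniteDimensional F E] [IsGalois F E]

theorem nrm_spec (v : TG m E) : mp (algebraMap F E) (nrm m F E v) =
      ∏ σ : E ≃ₐ[F] E, mp (σ : E →+* E) v := (exists_norm m F E).choose_spec.1 v

theorem nrm_surj : Function.Surjective (nrm m F E) := (exists_norm m F E).choose_spec.2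

theorem nrm_gal (τ : E ≃ₐ[F] E) (v : TG m E) : nrm m F E (mp (τ : E →+* E) v) = nrm m F E v := by
  apply mp_inj (algebraMap F E)
  rw [nrm_spec, nrm_spec]
  rw [← Equiv.prod_comp (Equiv.mulRight τ) (fun σ : E ≃ₐ[F] E => mp (σ : E →+* E) v)]
  rfl

theorem nrm_lin (a : E) (G : F[X]) (hG : G.map (algebraMap F E) = ∏ σ : E ≃ₐ[F] E, (X - C (σ a))) :
    nrm m F E (lin m a) = tr m ((G.reverse : F[X]) : PowerSeries F) := by
  apply mp_inj (algebraMap F E)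
  rw [nrm_spec, mp_tr]
  have h1 : PowerSeries.map (algebraMap F E) ((G.reverse : F[X]) : PowerSeries F) =
      ((∏ σ : E ≃ₐ[F] E, (1 - C (σ a) * X) : E[X]) : PowerSeries E) := by
    rw [← reverse_prod_lin, ← hG]
    ext n
    rw [PowerSeries.coeff_map, coeff_coe, coeff_coe, coeff_reverse, coeff_reverse, coeff_map, natDegree_map]
  have h2 : ((∏ σ : E ≃ₐ[F] E, (1 - C (σ a) * X) : E[X]) : PowerSeries E) =
      ∏ σ : E ≃ₐ[F] E, (1 - PowerSeries.C (σ a) * PowerSeries.X) := by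
    have := map_prod (Polynomial.coeToPowerSeries.ringHom (R := E)) (fun σ : E ≃ₐ[F] E => (1 - C (σ a) * X)) Finset.univ
    refine this.trans (Finset.prod_congr rfl (fun σ _ => ?_))
    simp
  rw [h1, h2, (tr_prod _ _ (fun σ _ => lin0 _)).2]
  apply Finset.prod_congr rfl
  intro σ _
  rw [lin, mp_tr]
  simp
end
end TG

end Part6

section Part7
open Polynomial

namespace TG

noncomputable instance extFintype (F : Type*) [Field F] [Fintype F] (p : ℕ) [Fact p.Prime] [CharP F p] (n : ℕ) [NeZero n] :
    Fintype (FiniteField.Extension F p n) := Fintype.ofFinite _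

theorem card_ext (F : Type*) [Field F] [Fintype F] (p : ℕ) [Fact p.Prime] [CharP F p] (n : ℕ) [NeZero n] :
    Fintype.card (FiniteField.Extension F p n) = Fintype.card F ^ n := by
  rw [← Nat.card_eq_fintype_card, FiniteField.natCard_extension, Nat.card_eq_fintype_card]

section
variable {m : ℕ} {F : Type*} [Field F] [Fintype F] (p : ℕ) [Fact p.Prime] [CharP F p]

/-- the character sum over the extension of degree `k+1` -/
noncomputable def SS (χ : TG m F →* ℂ) (k : ℕ) : ℂ :=
  ∑ a : FiniteField.Extension F p (k + 1), χ (nrm m F (FiniteField.Extension F p (k + 1)) (lin m a))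

theorem SS_even (χ : TG m F →* ℂ) (hχ : χ ≠ 1) : ∃ C s0 : ℕ, ∀ s k : ℕ, s0 ≤ s → k + 1 = 2 * s →
    ‖SS p χ k‖ ≤ C * (Fintype.card F : ℝ) ^ s := by
  set q := Fintype.card F with hq
  have hq2 : 2 ≤ q := Fintype.one_lt_card
  obtain ⟨f, hp, hf⟩ := FiniteField.card F p
  refine ⟨2 * gapB q m + 1, gapB q m ^ 2 + 3 * gapB q m + 1, ?_⟩
  intro s k hs hk
  let E := FiniteField.Extension F p (k + 1)
  have : CharP E p := charP_of_injective_algebraMap (algebraMap F E).injective p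
  have hqs : q ^ s = p ^ (f * s : ℕ) := by rw [pow_mul, ← hf]
  have hE : Fintype.card E = p ^ (f * s : ℕ) * p ^ (f * s : ℕ) := by
    rw [card_ext, ← hq, hk, ← hqs, two_mul, pow_add]
  have h := weil_E q m hq2 E p (f * s) hE ?_ ((FiniteField.frobeniusAlgEquivOfAlgebraic F E : E ≃ₐ[F] E) : E →+* E) ?_
    (χ.comp (nrm m F E)) ?_ ?_
  · have e : ((q : ℝ) ^ s) = (p : ℝ) ^ (f * s : ℕ) := by exact_mod_cast hqs
    rw [e]
    exact h
  · rw [← hqs]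
    exact lt_of_le_of_lt hs (Nat.lt_pow_self hq2)
  · intro x
    simp [FiniteField.coe_frobeniusAlgEquivOfAlgebraic, hq]
  · intro w
    rw [MonoidHom.comp_apply, MonoidHom.comp_apply, nrm_gal]
  · intro h
    apply hχ
    ext g
    obtain ⟨v, rfl⟩ := nrm_surj (m := m) (F := F) (E := E) g
    exact DFunLike.congr_fun h v
end
end TG

end Part7

section Part8
open Polynomial

namespace TG

section count
variable {F : Type*} [Field F] [Fintype F] (p : ℕ) [Fact p.Prime] [CharP F p]

theorem card_minpoly_eq [DecidableEq F[X]] (P : F[X]) (hP : Irreducible P) (hm : P.Monic) (n : ℕ) [NeZero n] :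
    (Finset.univ.filter (fun a : FiniteField.Extension F p n => minpoly F a = P)).card =
      if P.natDegree ∣ n then P.natDegree else 0 := by
  classical
  split_ifs with h
  · have hs : (P.map (algebraMap F (FiniteField.Extension F p n))).Splits := by
      have h1 := hP.natDegree_dvd_iff_dvd_X_pow_card_pow_sub_X.1 h
      refine Splits.of_dvd ?_ ?_ (Polynomial.map_dvd (algebraMap F (FiniteField.Extension F p n)) h1)
      · exact IsSplittingField.splits _ _
      · exact map_ne_zero (FiniteField.X_pow_card_pow_sub_X_ne_zero _ (NeZero.ne n) Finite.one_lt_card)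
    rw [← card_rootSet_eq_natDegree (PerfectField.separable_of_irreducible hP) hs, ← Set.toFinset_card]
    congr 1
    ext a
    simp only [Finset.mem_filter, Finset.mem_univ, true_and, Set.mem_toFinset, mem_rootSet]
    constructor
    · intro h
      refine ⟨hP.ne_zero, ?_⟩
      rw [← h]; exact minpoly.aeval _ _
    · intro h
      exact (minpoly.eq_of_irreducible_of_monic hP h.2 hm).symm
  · rw [Finset.card_eq_zero, Finset.filter_eq_empty_iff]
    intro a _ ha
    apply h
    rw [← ha]
    have := minpoly.degree_dvd (K := F) (x := a) (Algebra.IsIntegral.isIntegral a)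
    rwa [FiniteField.finrank_extension] at this

/-- exponent -/
noncomputable def cpE (n : ℕ) [NeZero n] (a : FiniteField.Extension F p n) : F[X] :=
  (minpoly F a) ^ (n / (minpoly F a).natDegree)

theorem cpE_spec (n : ℕ) [NeZero n] (a : FiniteField.Extension F p n) :
    (cpE p n a).map (algebraMap F _) = ∏ σ : FiniteField.Extension F p n ≃ₐ[F] FiniteField.Extension F p n, (X - C (σ a)) ∧
      (cpE p n a).Monic ∧ (cpE p n a).natDegree = n := by
  have hint : IsIntegral F a := Algebra.IsIntegral.isIntegral a
  obtain ⟨k, hk1, hk2⟩ := exists_cp F a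
  rw [FiniteField.finrank_extension] at hk2
  have hk : k = n / (minpoly F a).natDegree :=
    (Nat.div_eq_of_eq_mul_left (minpoly.natDegree_pos hint) hk2.symm).symm
  rw [cpE, ← hk]
  refine ⟨hk1, (minpoly.monic hint).pow k, by rw [natDegree_pow, hk2]⟩

theorem count_j (n δ v : ℕ) (hδ : 0 < δ) (h : v * δ ≤ n) :
    ∑ j ∈ Finset.range n, (if δ ∣ j + 1 ∧ (j + 1) / δ ≤ v then δ else 0) = v * δ := by
  rw [← Finset.sum_filter, Finset.sum_const, smul_eq_mul]
  congr 1
  have : (Finset.range n).filter (fun j => δ ∣ j + 1 ∧ (j + 1) / δ ≤ v) =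
      (Finset.range v).image (fun i => (i + 1) * δ - 1) := by
    ext j
    simp only [Finset.mem_filter, Finset.mem_range, Finset.mem_image]
    constructor
    · rintro ⟨_, ⟨c, hc⟩, h2⟩
      rw [hc, Nat.mul_div_cancel_left _ hδ] at h2
      rcases c with _ | c
      · simp at hc
      · refine ⟨c, by omega, ?_⟩
        rw [mul_comm, ← hc]; rfl
    · rintro ⟨i, hi, rfl⟩
      have h1 : (i + 1) * δ ≤ v * δ := Nat.mul_le_mul_right _ (by omega)
      have h0 : 0 < (i + 1) * δ := by positivity
      have e : (i + 1) * δ - 1 + 1 = (i + 1) * δ := by omega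
      rw [e]
      refine ⟨by omega, dvd_mul_left _ _, ?_⟩
      rw [Nat.mul_div_cancel _ hδ]; omega
  rw [this, Finset.card_image_of_injOn, Finset.card_range]
  intro a _ b _ hab
  simp only at hab
  have ha : 0 < (a + 1) * δ := by positivity
  have hb : 0 < (b + 1) * δ := by positivity
  have : (a + 1) * δ = (b + 1) * δ := by omega
  have := Nat.eq_of_mul_eq_mul_right hδ this
  omega

open UniqueFactorizationMonoid in
open Classical in
theorem count_main (h : F[X]) (hm : h.Monic) (n : ℕ) (hn : h.natDegree = n) :
    ∑ j ∈ Finset.range n, (Finset.univ.filter (fun a : FiniteField.Extension F p (j + 1) => cpE p (j + 1) a ∣ h)).card = n := by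
  have h0 := hm.ne_zero
  set s := normalizedFactors h with hs
  have hsirr : ∀ P ∈ s, Irreducible P := fun P hP => irreducible_of_normalized_factor P hP
  have hsmon : ∀ P ∈ s, P.Monic := fun P hP => by
    rw [← normalize_normalized_factor P hP]
    exact monic_normalize (hsirr P hP).ne_zero
  have hpow : ∀ P ∈ s, ∀ i, P ^ i ∣ h ↔ i ≤ s.count P := by
    intro P hP i
    rw [pow_dvd_iff_le_emultiplicity, emultiplicity_eq_count_normalizedFactors (hsirr P hP) h0,
      (hsmon P hP).normalize_eq_self]
    norm_cast
  have hdeg : n = ∑ P ∈ s.toFinset, s.count P * P.natDegree := by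
    have h1 : s.prod = h := by rw [hs, prod_normalizedFactors_eq h0, hm.normalize_eq_self]
    have h2 := natDegree_multiset_prod s (fun h => (hsirr 0 h).ne_zero rfl)
    rw [h1, hn, Finset.sum_multiset_map_count] at h2
    simpa using h2
  have step : ∀ j, (Finset.univ.filter (fun a : FiniteField.Extension F p (j + 1) => cpE p (j + 1) a ∣ h)).card =
      ∑ P ∈ s.toFinset, if P.natDegree ∣ j + 1 ∧ (j + 1) / P.natDegree ≤ s.count P then P.natDegree else 0 := by
    intro j
    rw [Finset.card_eq_sum_card_fiberwise (f := fun a => minpoly F a) (t := s.toFinset)]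
    · apply Finset.sum_congr rfl
      intro P hP
      rw [Multiset.mem_toFinset] at hP
      rw [Finset.filter_filter]
      by_cases hle : (j + 1) / P.natDegree ≤ s.count P
      · simp only [hle, and_true]
        rw [← card_minpoly_eq p P (hsirr P hP) (hsmon P hP) (j + 1)]
        congr 1
        ext a
        simp only [Finset.mem_filter, Finset.mem_univ, true_and]
        constructor
        · exact fun h => h.2
        · intro ha
          refine ⟨?_, ha⟩
          rw [cpE, ha, hpow P hP]; exact hle
      · simp only [hle, and_false, if_false]
        rw [Finset.card_eq_zero, Finset.filter_eq_empty_iff]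
        rintro a _ ⟨h1, h2⟩
        rw [cpE, h2, hpow P hP] at h1
        exact hle h1
    · intro a ha
      simp only [Finset.coe_filter, Finset.mem_univ, true_and, Set.mem_ofPred_eq] at ha
      have hint : IsIntegral F a := Algebra.IsIntegral.isIntegral a
      have hdv : minpoly F a ∣ h := by
        refine (dvd_pow_self _ ?_).trans ha
        have h1 := minpoly.degree_dvd (K := F) hint
        rw [FiniteField.finrank_extension] at h1
        exact (Nat.div_pos (Nat.le_of_dvd (by omega) h1) (minpoly.natDegree_pos hint)).ne'
      obtain ⟨Q, hQ, hQa⟩ := exists_mem_normalizedFactors_of_dvd h0 (minpoly.irreducible hint) hdv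
      have := (normalize_eq_normalize_iff_associated.2 hQa)
      rw [normalize_normalized_factor Q hQ, (minpoly.monic hint).normalize_eq_self] at this
      change minpoly F a ∈ s.toFinset
      rw [this, Multiset.mem_toFinset]; exact hQ
  simp only [step]
  rw [Finset.sum_comm]
  conv_rhs => rw [hdeg]
  apply Finset.sum_congr rfl
  intro P hP
  rw [count_j]
  · exact (hsirr P (Multiset.mem_toFinset.1 hP)).natDegree_pos
  · rw [hdeg]
    exact Finset.single_le_sum (f := fun P => s.count P * P.natDegree) (fun _ _ => Nat.zero_le _) hP

end count
end TG

end Part8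

section Part9
open Polynomial

namespace TG

section
variable {m : ℕ} {F : Type*} [Field F] [Fintype F] 

/-- monic polynomial from coefficients -/
noncomputable def toPoly {n : ℕ} (c : TG n F) : F[X] := reflect n (PowerSeries.trunc (n + 1) (ps c))

theorem coe_trunc {n : ℕ} (c : TG n F) : ((PowerSeries.trunc (n + 1) (ps c) : F[X]) : PowerSeries F) = ps c := by
  ext i
  rw [coeff_coe, PowerSeries.coeff_trunc]
  split_ifs with h
  · rfl
  · rw [coeff_ps]
    rcases i with _ | i
    · omega
    · simp only [extW]; rw [dif_neg (by omega)]

theorem toPoly_spec {n : ℕ} (c : TG n F) : (toPoly c).Monic ∧ (toPoly c).natDegree = n := by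
  have hle : (toPoly c).natDegree ≤ n := by
    refine natDegree_reflect_le.trans (max_le le_rfl ?_)
    exact Nat.lt_succ_iff.1 (PowerSeries.natDegree_trunc_lt _ _)
  have hc : (toPoly c).coeff n = 1 := by
    rw [toPoly, coeff_reflect, revAt_le le_rfl, Nat.sub_self, PowerSeries.coeff_trunc, if_pos (by omega), ps_zero]
  have hm := monic_of_natDegree_le_of_coeff_eq_one n hle hc
  refine ⟨hm, le_antisymm hle ?_⟩
  exact le_natDegree_of_ne_zero (by rw [hc]; exact one_ne_zero)

theorem reverse_toPoly {n : ℕ} (c : TG n F) : (((toPoly c).reverse : F[X]) : PowerSeries F) = ps c := by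
  rw [reverse, (toPoly_spec c).2, toPoly, reflect_reflect, coe_trunc]

theorem toPoly_inj {n : ℕ} : Function.Injective (toPoly (F := F) (n := n)) := by
  intro a b h
  rw [← tr_ps a, ← tr_ps b, ← reverse_toPoly, ← reverse_toPoly, h]

theorem coeff0_rev {h : F[X]} (hm : h.Monic) : PowerSeries.coeff 0 ((h.reverse : F[X]) : PowerSeries F) = 1 := by
  rw [coeff_coe, coeff_zero_reverse, hm]

open Classical in
/-- monic polynomials of degree n -/
noncomputable def Mon (F : Type*) [Field F] [Fintype F] (n : ℕ) : Finset F[X] :=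
  Finset.univ.image (toPoly (F := F) (n := n))

theorem mem_Mon {n : ℕ} {h : F[X]} : h ∈ Mon F n ↔ h.Monic ∧ h.natDegree = n := by
  classical
  rw [Mon, Finset.mem_image]
  constructor
  · rintro ⟨c, _, rfl⟩; exact toPoly_spec c
  · rintro ⟨hm, hn⟩
    refine ⟨tr n (h.reverse : F[X]), Finset.mem_univ _, ?_⟩
    have : PowerSeries.trunc (n + 1) (ps (tr n ((h.reverse : F[X]) : PowerSeries F))) = h.reverse := by
      ext i
      rw [PowerSeries.coeff_trunc]
      split_ifs with hi
      · rw [agree_ps_tr (coeff0_rev hm) i (by omega), coeff_coe]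
      · rw [coeff_eq_zero_of_natDegree_lt]
        have := reverse_natDegree_le h
        omega
    rw [toPoly, this, reverse, hn, reflect_reflect]

/-- the completely multiplicative function -/
noncomputable def psi (χ : TG m F →* ℂ) (h : F[X]) : ℂ := χ (tr m ((h.reverse : F[X]) : PowerSeries F))

theorem psi_mul (χ : TG m F →* ℂ) {h g : F[X]} (hh : h.Monic) (hg : g.Monic) :
    psi χ (h * g) = psi χ h * psi χ g := by
  rw [psi, reverse_mul_of_domain, coe_mul, tr_mul (coeff0_rev hh) (coeff0_rev hg), map_mul]; rfl

/-- sums over monic polynomials -/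
noncomputable def AA (χ : TG m F →* ℂ) (n : ℕ) : ℂ := ∑ c : TG n F, χ (tr m (ps c))

theorem AA_eq (χ : TG m F →* ℂ) (n : ℕ) : AA χ n = ∑ h ∈ Mon F n, psi χ h := by
  classical
  rw [Mon, Finset.sum_image (fun a _ b _ h => toPoly_inj h)]
  simp only [psi, reverse_toPoly]; rfl

open Classical in
theorem sum_dvd (χ : TG m F →* ℂ) (n j : ℕ) (hj : j ≤ n) (P : F[X]) (hP : P.Monic) (hPd : P.natDegree = j) :
    ∑ h ∈ (Mon F n).filter (fun h => P ∣ h), psi χ h = psi χ P * AA χ (n - j) := by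
  rw [AA_eq, Finset.mul_sum]
  symm
  refine Finset.sum_bij (fun h _ => P * h) ?_ ?_ ?_ ?_
  · intro h hh
    rw [mem_Mon] at hh
    rw [Finset.mem_filter, mem_Mon, hP.natDegree_mul hh.1]
    exact ⟨⟨hP.mul hh.1, by omega⟩, dvd_mul_right _ _⟩
  · intro a _ b _ hab
    exact mul_left_cancel₀ hP.ne_zero hab
  · intro h hh
    rw [Finset.mem_filter, mem_Mon] at hh
    obtain ⟨⟨hm, hd⟩, g, rfl⟩ := hh
    have hg := hP.of_mul_monic_left hm
    rw [hP.natDegree_mul hg] at hd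
    exact ⟨g, by rw [mem_Mon]; exact ⟨hg, by omega⟩, rfl⟩
  · intro h hh
    rw [mem_Mon] at hh
    rw [psi_mul χ hP hh.1]

theorem newton (p : ℕ) [Fact p.Prime] [CharP F p] (χ : TG m F →* ℂ) (n : ℕ) :
    (n : ℂ) * AA χ n = ∑ j ∈ Finset.range n, SS p χ j * AA χ (n - (j + 1)) := by
  classical
  have h1 : ∀ h ∈ Mon F n, (n : ℂ) * psi χ h = ∑ j ∈ Finset.range n,
      ∑ a : FiniteField.Extension F p (j + 1), if cpE p (j + 1) a ∣ h then psi χ h else 0 := by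
    intro h hh
    rw [mem_Mon] at hh
    have := count_main p h hh.1 n hh.2
    conv_lhs => rw [← this]
    push_cast
    rw [Finset.sum_mul]
    apply Finset.sum_congr rfl
    intro j _
    rw [← Finset.sum_filter, Finset.sum_const, nsmul_eq_mul]
  rw [AA_eq, Finset.mul_sum, Finset.sum_congr rfl h1, Finset.sum_comm]
  apply Finset.sum_congr rfl
  intro j hj
  rw [Finset.mem_range] at hj
  rw [Finset.sum_comm, SS, Finset.sum_mul]
  apply Finset.sum_congr rfl
  intro a _
  obtain ⟨c1, c2, c3⟩ := cpE_spec p (j + 1) a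
  rw [← Finset.sum_filter, sum_dvd χ n (j + 1) hj _ c2 c3, nrm_lin a _ c1]; rfl

theorem AA_zero (χ : TG m F →* ℂ) : AA χ 0 = 1 := by
  have : ∀ c : TG 0 F, tr m (ps c) = 1 := by
    intro c
    rw [← tr_one]
    congr 1
    ext i
    rw [coeff_ps, PowerSeries.coeff_one]
    rcases i with _ | i
    · simp [extW]
    · simp [extW]
  simp only [AA, this, map_one, Finset.sum_const, Finset.card_univ, card_eq]
  simp

theorem AA_big (χ : TG m F →* ℂ) (hχ : χ ≠ 1) (n : ℕ) (hn : m ≤ n) : AA χ n = 0 := by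
  classical
  -- pick translation
  obtain ⟨g, hg⟩ : ∃ g, χ g ≠ 1 := by
    by_contra h
    push Not at h
    exact hχ (MonoidHom.ext h)
  let gn : TG n F := tr n (ps g)
  have hgn : tr m (ps gn) = g := by
    conv_rhs => rw [← tr_ps g]
    rw [tr_eq_iff (ps_zero _) (ps_zero _)]
    intro i hi
    exact agree_ps_tr (ps_zero g) i (by omega)
  have hmul : ∀ c : TG n F, tr m (ps (gn * c)) = g * tr m (ps c) := by
    intro c
    rw [← hgn, ← tr_mul (ps_zero _) (ps_zero _), tr_eq_iff (ps_zero _) (coeff0_mul (ps_zero _) (ps_zero _))]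
    intro i hi
    exact agree_ps_tr (coeff0_mul (ps_zero _) (ps_zero _)) i (by omega)
  have h1 : AA χ n = χ g * AA χ n := by
    conv_lhs => rw [AA, ← Equiv.sum_comp (Equiv.mulLeft gn)]
    simp only [Equiv.coe_mulLeft, hmul, map_mul, ← Finset.mul_sum]
    rfl
  have h2 : (χ g - 1) * AA χ n = 0 := by rw [sub_mul, one_mul, ← h1, sub_self]
  exact (mul_eq_zero.1 h2).resolve_left (sub_ne_zero.2 hg)

end
end TG

end Part9

section Part10
open Polynomial

theorem powsum_bound {ι : Type*} [Fintype ι] (z : ι → ℂ) (C : ℝ) (s0 : ℕ)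
    (h : ∀ s, s0 ≤ s → ‖∑ i, z i ^ s‖ ≤ C) (i0 : ι) : ‖z i0‖ ≤ 1 := by
  classical
  by_contra hgt
  push Not at hgt
  let V : Finset ℂ := (Finset.univ.image z).erase (z i0)
  let P : ℂ[X] := ∏ v ∈ V, (X - Polynomial.C v)
  have hP0 : ∀ i, z i ≠ z i0 → P.eval (z i) = 0 := by
    intro i hi
    simp only [P, eval_prod]
    apply Finset.prod_eq_zero (i := z i)
    · simp [V, hi]
    · simp
  have hP1 : P.eval (z i0) ≠ 0 := by
    simp only [P, eval_prod]
    rw [Finset.prod_ne_zero_iff]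
    intro v hv
    simp only [V, Finset.mem_erase] at hv
    simp [sub_eq_zero, Ne.symm hv.1]
  let μ : ℕ := (Finset.univ.filter (fun i => z i = z i0)).card
  have hμ : 1 ≤ μ := Finset.card_pos.2 ⟨i0, by simp⟩
  have key : ∀ s, ∑ k ∈ Finset.range (P.natDegree + 1), P.coeff k * ∑ i, z i ^ (s + k) =
      μ * (z i0 ^ s * P.eval (z i0)) := by
    intro s
    simp only [Finset.mul_sum]
    rw [Finset.sum_comm]
    have : ∀ i, ∑ k ∈ Finset.range (P.natDegree + 1), P.coeff k * z i ^ (s + k) =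
        if z i = z i0 then z i0 ^ s * P.eval (z i0) else 0 := by
      intro i
      have e : ∑ k ∈ Finset.range (P.natDegree + 1), P.coeff k * z i ^ (s + k) = z i ^ s * P.eval (z i) := by
        rw [eval_eq_sum_range, Finset.mul_sum]
        apply Finset.sum_congr rfl
        intro k _
        rw [pow_add]; ring
      rw [e]
      split_ifs with hh
      · rw [hh]
      · rw [hP0 i hh, mul_zero]
    simp only [this]
    rw [← Finset.sum_filter, Finset.sum_const, nsmul_eq_mul]
  let D : ℝ := ∑ k ∈ Finset.range (P.natDegree + 1), ‖P.coeff k‖ * C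
  have hb : ∀ s, s0 ≤ s → ‖z i0‖ ^ s * ‖P.eval (z i0)‖ ≤ D := by
    intro s hs
    have h1 : ‖(μ : ℂ) * (z i0 ^ s * P.eval (z i0))‖ ≤ D := by
      rw [← key s]
      refine (norm_sum_le _ _).trans (Finset.sum_le_sum ?_)
      intro k _
      rw [norm_mul]
      exact mul_le_mul_of_nonneg_left (h _ (by omega)) (norm_nonneg _)
    rw [norm_mul, norm_mul, norm_pow, Complex.norm_natCast] at h1
    have h2 : (1 : ℝ) ≤ μ := by exact_mod_cast hμ
    have h3 : 0 ≤ ‖z i0‖ ^ s * ‖P.eval (z i0)‖ := by positivity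
    nlinarith
  have hpos : 0 < ‖P.eval (z i0)‖ := norm_pos_iff.2 hP1
  have ht := (tendsto_pow_atTop_atTop_of_one_lt hgt)
  obtain ⟨s, hs⟩ := ((ht.eventually_gt_atTop (D / ‖P.eval (z i0)‖)).and (Filter.eventually_ge_atTop s0)).exists
  have := hb s hs.2
  rw [div_lt_iff₀ hpos] at hs
  linarith [hs.1]

theorem ms_fun (R : Multiset ℂ) (M : ℕ) (h : R.card = M) :
    ∃ ω : Fin M → ℂ, (Finset.univ : Finset (Fin M)).val.map ω = R := by
  have hl : R.toList.length = M := by rw [Multiset.length_toList, h]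
  clear h
  subst hl
  refine ⟨fun i => R.toList.get i, ?_⟩
  rw [Fin.univ_val_map, List.ofFn_get, Multiset.coe_toList]

theorem analytic (M : ℕ) (A S : ℕ → ℂ) (hA0 : A 0 = 1) (hA : ∀ n, M < n → A n = 0)
    (hN : ∀ n : ℕ, (n : ℂ) * A n = ∑ j ∈ Finset.range n, S j * A (n - (j + 1)))
    (q : ℝ) (hq : 0 < q) (C s0 : ℕ) (hS : ∀ s k : ℕ, s0 ≤ s → k + 1 = 2 * s → ‖S k‖ ≤ C * q ^ s) (n : ℕ) :
    ‖A n‖ ≤ (M.choose n : ℝ) * Real.sqrt q ^ n := by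
  classical
  let Q : ℂ[X] := ∑ i ∈ Finset.range (M + 1), Polynomial.C (A i) * X ^ (M - i)
  have hQc : ∀ i ≤ M, Q.coeff (M - i) = A i := by
    intro i hi
    simp only [Q, finsetSum_coeff, coeff_C_mul, coeff_X_pow]
    rw [Finset.sum_eq_single i]
    · simp
    · intro j hj hji
      rw [Finset.mem_range] at hj
      rw [if_neg (by omega), mul_zero]
    · intro h; exact absurd (Finset.mem_range.2 (by omega)) h
  have hQle : Q.natDegree ≤ M := by
    apply natDegree_sum_le_of_forall_le
    intro i _
    exact (natDegree_C_mul_X_pow_le _ _).trans (by omega)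
  have hQ1 : Q.coeff M = 1 := by rw [← hA0, ← hQc 0 (by omega)]; simp
  have hQm : Q.Monic := monic_of_natDegree_le_of_coeff_eq_one M hQle hQ1
  have hQd : Q.natDegree = M := le_antisymm hQle (le_natDegree_of_ne_zero (by rw [hQ1]; exact one_ne_zero))
  have hcard : Q.roots.card = M := by
    rw [← hQd]; exact (IsAlgClosed.splits Q).natDegree_eq_card_roots.symm
  obtain ⟨ω, hω⟩ : ∃ ω : Fin M → ℂ, (Finset.univ : Finset (Fin M)).val.map ω = Q.roots := by
    exact ms_fun _ _ hcard
  have hAe : ∀ n, A n = (-1) ^ n * MvPolynomial.aeval ω (MvPolynomial.esymm (Fin M) ℂ n) := by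
    intro n
    rw [MvPolynomial.aeval_esymm_eq_multiset_esymm, hω]
    by_cases hn : n ≤ M
    · have := coeff_eq_esymm_roots_of_card (p := Q) (by rw [hcard, hQd]) (k := M - n) (by omega)
      rw [hQc n hn, hQd, hQm, one_mul, show M - (M - n) = n by omega] at this
      exact this
    · rw [hA n (by omega), Multiset.esymm, Multiset.powersetCard_eq_empty _ (by rw [hcard]; omega)]
      simp
  have hNp : ∀ n : ℕ, (n : ℂ) * A n = ∑ j ∈ Finset.range n, (-∑ i, ω i ^ (j + 1)) * A (n - (j + 1)) := by
    intro n
    have h1 := congrArg (MvPolynomial.aeval ω) (MvPolynomial.mul_esymm_eq_sum (Fin M) ℂ n)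
    simp only [map_mul, map_natCast, map_pow, map_neg, map_one, map_sum] at h1
    have h2 : ∑ a ∈ (Finset.HasAntidiagonal.antidiagonal n).filter (fun a => a.1 < n), (-1) ^ a.1 *
        MvPolynomial.aeval ω (MvPolynomial.esymm (Fin M) ℂ a.1) * MvPolynomial.aeval ω (MvPolynomial.psum (Fin M) ℂ a.2) =
        ∑ j ∈ Finset.range n, (∑ i, ω i ^ (j + 1)) * A (n - (j + 1)) := by
      refine Finset.sum_bij' (fun a _ => a.2 - 1) (fun j _ => (n - (j + 1), j + 1)) ?_ ?_ ?_ ?_ ?_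
      · rintro ⟨a, b⟩ h
        simp only [Finset.mem_filter, Finset.HasAntidiagonal.mem_antidiagonal, Finset.mem_range] at h ⊢
        omega
      · intro j h
        simp only [Finset.mem_filter, Finset.HasAntidiagonal.mem_antidiagonal, Finset.mem_range] at h ⊢
        omega
      · rintro ⟨a, b⟩ h
        simp only [Finset.mem_filter, Finset.HasAntidiagonal.mem_antidiagonal, Prod.mk.injEq] at h ⊢
        omega
      · intro j h; simp
      · rintro ⟨a, b⟩ h
        simp only [Finset.mem_filter, Finset.HasAntidiagonal.mem_antidiagonal] at h
        have e1 : b - 1 + 1 = b := by omega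
        have e2 : n - b = a := by omega
        simp only [e1, e2, MvPolynomial.psum, map_sum, map_pow, MvPolynomial.aeval_X]
        rw [hAe a]; ring
    rw [h2] at h1
    rw [hAe n]
    have h3 : ((-1 : ℂ) ^ n) * (-1) ^ n = 1 := by rw [← mul_pow]; simp
    simp only [neg_mul, Finset.sum_neg_distrib]
    rw [mul_left_comm, h1, pow_succ]
    linear_combination (-(∑ j ∈ Finset.range n, (∑ i, ω i ^ (j + 1)) * A (n - (j + 1)))) * h3
  have hSp : ∀ n, S n = -∑ i, ω i ^ (n + 1) := by
    intro n
    induction n using Nat.strong_induction_on with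
    | _ n ih =>
      have h1 := hN (n + 1)
      rw [hNp (n + 1), Finset.sum_range_succ, Finset.sum_range_succ, Nat.sub_self, hA0, mul_one, mul_one] at h1
      have h2 : ∑ j ∈ Finset.range n, (-∑ i, ω i ^ (j + 1)) * A (n + 1 - (j + 1)) =
          ∑ j ∈ Finset.range n, S j * A (n + 1 - (j + 1)) := by
        apply Finset.sum_congr rfl
        intro j hj
        rw [ih j (Finset.mem_range.1 hj)]
      rw [h2] at h1
      exact (add_left_cancel h1).symm
  have hω1 : ∀ i, ‖ω i‖ ≤ Real.sqrt q := by
    intro i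
    have h1 := powsum_bound (fun i => ω i ^ 2 / (q : ℂ)) C (s0 + 1) (by
      intro s hs
      have h2 := hS s (2 * s - 1) (by omega) (by omega)
      rw [hSp, norm_neg, show 2 * s - 1 + 1 = 2 * s by omega] at h2
      have e : ∑ i, (ω i ^ 2 / (q : ℂ)) ^ s = (∑ i, ω i ^ (2 * s)) / (q : ℂ) ^ s := by
        rw [Finset.sum_div]
        apply Finset.sum_congr rfl
        intro i _
        rw [div_pow, pow_mul]
      rw [e, norm_div, norm_pow, Complex.norm_real, Real.norm_of_nonneg hq.le, div_le_iff₀ (by positivity)]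
      exact h2) i
    rw [norm_div, norm_pow, Complex.norm_real, Real.norm_of_nonneg hq.le, div_le_one hq] at h1
    exact Real.le_sqrt_of_sq_le h1
  rw [hAe n, norm_mul, norm_pow, norm_neg, norm_one, one_pow, one_mul]
  simp only [MvPolynomial.esymm, map_sum, map_prod, MvPolynomial.aeval_X]
  refine (norm_sum_le _ _).trans ?_
  have : ∀ t ∈ Finset.powersetCard n (Finset.univ : Finset (Fin M)), ‖∏ i ∈ t, ω i‖ ≤ Real.sqrt q ^ n := by
    intro t ht
    rw [Finset.mem_powersetCard] at ht
    rw [norm_prod, ← ht.2, ← Finset.prod_const]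
    exact Finset.prod_le_prod (fun _ _ => norm_nonneg _) (fun i _ => hω1 i)
  refine (Finset.sum_le_sum this).trans ?_
  rw [Finset.sum_const, Finset.card_powersetCard, Finset.card_univ, Fintype.card_fin, nsmul_eq_mul]

theorem TG.AA_bound {m : ℕ} {F : Type*} [Field F] [Fintype F] (p : ℕ) [Fact p.Prime] [CharP F p]
    (hm : 1 ≤ m) (χ : TG m F →* ℂ) (hχ : χ ≠ 1) (n : ℕ) :
    ‖AA χ n‖ ≤ ((m - 1).choose n : ℝ) * Real.sqrt (Fintype.card F) ^ n := by
  obtain ⟨C, s0, h⟩ := SS_even p χ hχ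
  exact analytic (m - 1) (AA χ) (SS p χ) (AA_zero χ) (fun n hn => AA_big χ hχ n (by omega)) (newton p χ)
    _ (by exact_mod_cast Fintype.card_pos) C s0 h n

end Part10

section Part11
open Polynomial

section
variable {σ : Type*} [Fintype σ]

theorem emb_sum [DecidableEq σ] (z : σ → ℂ) (r : ℕ) :
    ∑ x : Fin r ↪ σ, ∏ j, z (x j) = (r.factorial : ℂ) * MvPolynomial.aeval z (MvPolynomial.esymm σ ℂ r) := by
  classical
  have hm : ∀ x ∈ (Finset.univ : Finset (Fin r ↪ σ)),
      (Finset.univ.map x) ∈ Finset.powersetCard r (Finset.univ : Finset σ) := by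
    intro x _
    simp [Finset.mem_powersetCard]
  rw [← Finset.sum_fiberwise_of_maps_to hm]
  simp only [MvPolynomial.esymm, map_sum, map_prod, MvPolynomial.aeval_X, Finset.mul_sum]
  apply Finset.sum_congr rfl
  intro t ht
  rw [Finset.mem_powersetCard] at ht
  have h1 : ∀ x ∈ Finset.univ.filter (fun x : Fin r ↪ σ => Finset.univ.map x = t), ∏ j, z (x j) = ∏ i ∈ t, z i := by
    intro x hx
    rw [Finset.mem_filter] at hx
    rw [← hx.2, Finset.prod_map]
  rw [Finset.sum_congr rfl h1, Finset.sum_const, nsmul_eq_mul]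
  congr 2
  have h2 : Fintype.card (Fin r ↪ t) = r.factorial := by
    rw [Fintype.card_embedding_eq, Fintype.card_coe, ht.2, Fintype.card_fin, Nat.descFactorial_self]
  rw [← h2, ← Finset.card_univ]
  symm
  refine Finset.card_bij (fun f _ => f.trans (Function.Embedding.subtype _)) ?_ ?_ ?_
  · intro f _
    rw [Finset.mem_filter]
    refine ⟨Finset.mem_univ _, Finset.eq_of_subset_of_card_le ?_ ?_⟩
    · intro a ha
      rw [Finset.mem_map] at ha
      obtain ⟨j, _, rfl⟩ := ha
      exact (f j).2
    · rw [Finset.card_map, Finset.card_univ, Fintype.card_fin, ht.2]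
  · intro f _ g _ h
    ext j
    exact DFunLike.congr_fun h j
  · intro x hx
    rw [Finset.mem_filter] at hx
    have h3 : ∀ j, x j ∈ t := fun j => by
      rw [← hx.2]; exact Finset.mem_map_of_mem _ (Finset.mem_univ _)
    refine ⟨⟨fun j => ⟨x j, h3 j⟩, fun a b hab => x.injective (Subtype.ext_iff.1 hab)⟩, Finset.mem_univ _, ?_⟩
    ext j
    rfl

/-- normalised rising factorial -/
noncomputable def Gr (A : ℝ) (r : ℕ) : ℝ := (∏ j ∈ Finset.range r, (A + j)) / r.factorial

theorem Gr_nonneg {A : ℝ} (hA : 1 ≤ A) (r : ℕ) : 0 ≤ Gr A r := by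
  unfold Gr
  have : ∀ j ∈ Finset.range r, 0 ≤ A + j := fun j _ => by positivity
  have := Finset.prod_nonneg this
  positivity

theorem Gr_succ (A : ℝ) (r : ℕ) : ((r : ℝ) + 1) * Gr A (r + 1) = (A + r) * Gr A r := by
  unfold Gr
  rw [Finset.prod_range_succ, Nat.factorial_succ]
  have : (r.factorial : ℝ) ≠ 0 := by positivity
  push_cast
  field_simp

theorem Gr_mono {A : ℝ} (hA : 1 ≤ A) : Monotone (Gr A) := by
  apply monotone_nat_of_le_succ
  intro r
  have h1 := Gr_succ A r
  have h2 := Gr_nonneg hA r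
  have h3 : (0 : ℝ) < (r : ℝ) + 1 := by positivity
  nlinarith

theorem Gr_sum (A : ℝ) (r : ℕ) : (r : ℝ) * Gr A r = A * ∑ i ∈ Finset.range r, Gr A i := by
  induction r with
  | zero => simp
  | succ r ih =>
    rw [Finset.sum_range_succ, mul_add, ← ih]
    push_cast
    rw [Gr_succ]; ring

theorem Gr_p {A : ℝ} (hA : 1 ≤ A) (p : ℕ) (hp : 1 ≤ p) (r : ℕ) :
    (p : ℝ) * ∑ i ∈ Finset.range r, (if p ∣ r - i then Gr A i else 0) ≤ ∑ i ∈ Finset.range r, Gr A i := by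
  induction r using Nat.strong_induction_on with
  | _ r ih =>
    by_cases h : r < p
    · rw [Finset.sum_eq_zero, mul_zero]
      · exact Finset.sum_nonneg (fun i _ => Gr_nonneg hA i)
      · intro i hi
        rw [Finset.mem_range] at hi
        rw [if_neg]
        intro hd
        have := Nat.le_of_dvd (by omega) hd
        omega
    · obtain ⟨s, rfl⟩ : ∃ s, r = s + p := ⟨r - p, by omega⟩
      have h1 := ih s (by omega)
      rw [Finset.sum_range_add, Finset.sum_range_add]
      have e1 : ∑ i ∈ Finset.range s, (if p ∣ s + p - i then Gr A i else 0) =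
          ∑ i ∈ Finset.range s, (if p ∣ s - i then Gr A i else 0) := by
        apply Finset.sum_congr rfl
        intro i hi
        rw [Finset.mem_range] at hi
        rw [show s + p - i = (s - i) + p by omega]
        simp
      have e2 : ∑ i ∈ Finset.range p, (if p ∣ s + p - (s + i) then Gr A (s + i) else 0) = Gr A s := by
        rw [Finset.sum_eq_single 0]
        · simp
        · intro i hi hi0
          rw [Finset.mem_range] at hi
          rw [if_neg]
          intro hd
          have := Nat.le_of_dvd (by omega) hd
          omega
        · intro h; exact absurd (Finset.mem_range.2 (by omega)) h
      have e3 : (p : ℝ) * Gr A s ≤ ∑ i ∈ Finset.range p, Gr A (s + i) := by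
        have := Finset.card_nsmul_le_sum (Finset.range p) (fun i => Gr A (s + i)) (Gr A s)
          (fun i _ => Gr_mono hA (by omega))
        rwa [Finset.card_range, nsmul_eq_mul] at this
      rw [e1, e2, mul_add]
      linarith

theorem esymm_bound (z : σ → ℂ) (p : ℕ) (hp : 1 ≤ p) (B Q : ℝ) (hQ : 0 ≤ Q) (hA : 1 ≤ Q / p + B)
    (h : ∀ j, 1 ≤ j → ‖∑ i, z i ^ j‖ ≤ B + if p ∣ j then Q else 0) (r : ℕ) :
    ‖MvPolynomial.aeval z (MvPolynomial.esymm σ ℂ r)‖ ≤ Gr (Q / p + B) r := by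
  classical
  induction r using Nat.strong_induction_on with
  | _ r ih =>
    rcases Nat.eq_zero_or_pos r with rfl | hr
    · simp [Gr]
    have h1 := congrArg (MvPolynomial.aeval z) (MvPolynomial.mul_esymm_eq_sum σ ℂ r)
    simp only [map_mul, map_natCast, map_pow, map_neg, map_one, map_sum] at h1
    set A := Q / p + B with hAd
    have h2 : ‖(r : ℂ) * MvPolynomial.aeval z (MvPolynomial.esymm σ ℂ r)‖ ≤
        ∑ i ∈ Finset.range r, Gr A i * (B + if p ∣ r - i then Q else 0) := by
      rw [h1, norm_mul, norm_pow, norm_neg, norm_one, one_pow, one_mul]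
      refine (norm_sum_le _ _).trans ?_
      have : ∑ i ∈ Finset.range r, Gr A i * (B + if p ∣ r - i then Q else 0) =
        ∑ a ∈ (Finset.HasAntidiagonal.antidiagonal r).filter (fun a => a.1 < r),
          Gr A a.1 * (B + if p ∣ a.2 then Q else 0) := by
        refine Finset.sum_bij' (fun i _ => (i, r - i)) (fun a _ => a.1) ?_ ?_ ?_ ?_ ?_
        · intro j h
          simp only [Finset.mem_filter, Finset.HasAntidiagonal.mem_antidiagonal, Finset.mem_range] at h ⊢
          omega
        · rintro ⟨a, b⟩ h
          simp only [Finset.mem_filter, Finset.HasAntidiagonal.mem_antidiagonal, Finset.mem_range] at h ⊢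
          omega
        · intro j h; rfl
        · rintro ⟨a, b⟩ h
          simp only [Finset.mem_filter, Finset.HasAntidiagonal.mem_antidiagonal] at h
          exact Prod.ext rfl (show r - a = b by omega)
        · intro j h; rfl
      rw [this]
      apply Finset.sum_le_sum
      rintro ⟨a, b⟩ hab
      simp only [Finset.mem_filter, Finset.HasAntidiagonal.mem_antidiagonal] at hab
      simp only [norm_mul, norm_pow, norm_neg, norm_one, one_pow, one_mul]
      have e := h b (by omega)
      simp only [MvPolynomial.psum, map_sum, map_pow, MvPolynomial.aeval_X]
      exact mul_le_mul (ih a hab.2) e (norm_nonneg _) (Gr_nonneg hA _)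
    have h3 : ∑ i ∈ Finset.range r, Gr A i * (B + if p ∣ r - i then Q else 0) ≤ r * Gr A r := by
      have e1 : ∑ i ∈ Finset.range r, Gr A i * (B + if p ∣ r - i then Q else 0) =
          B * ∑ i ∈ Finset.range r, Gr A i + Q * ∑ i ∈ Finset.range r, (if p ∣ r - i then Gr A i else 0) := by
        rw [Finset.mul_sum, Finset.mul_sum, ← Finset.sum_add_distrib]
        apply Finset.sum_congr rfl
        intro i _
        split_ifs <;> ring
      have e2 := Gr_p hA p hp r
      have hp0 : (0 : ℝ) < p := by exact_mod_cast hp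
      have e3 : Q * ∑ i ∈ Finset.range r, (if p ∣ r - i then Gr A i else 0) ≤
          Q / p * ∑ i ∈ Finset.range r, Gr A i := by
        calc _ = Q / p * (p * ∑ i ∈ Finset.range r, (if p ∣ r - i then Gr A i else 0)) := by field_simp
          _ ≤ _ := mul_le_mul_of_nonneg_left e2 (by positivity)
      rw [e1, Gr_sum, hAd, add_mul]
      linarith
    have h4 := h2.trans h3
    rw [norm_mul, Complex.norm_natCast] at h4
    exact le_of_mul_le_mul_left h4 (by exact_mod_cast hr)

theorem sieve_bound [DecidableEq σ] (z : σ → ℂ) (p : ℕ) (hp : 1 ≤ p) (B Q : ℝ) (hQ : 0 ≤ Q) (hA : 1 ≤ Q / p + B)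
    (h : ∀ j, 1 ≤ j → ‖∑ i, z i ^ j‖ ≤ B + if p ∣ j then Q else 0) (r : ℕ) :
    ‖∑ x : Fin r ↪ σ, ∏ j, z (x j)‖ ≤ ∏ j ∈ Finset.range r, (Q / p + B + j) := by
  rw [emb_sum, norm_mul, Complex.norm_natCast]
  have h1 := esymm_bound z p hp B Q hQ hA h r
  have h2 : (0 : ℝ) < r.factorial := by positivity
  rw [Gr, le_div_iff₀ h2] at h1
  linarith

end

namespace TG
section
variable {m : ℕ} {F : Type*} [Field F] [Fintype F]

theorem AA_one (χ : TG m F →* ℂ) : AA χ 1 = ∑ a : F, χ (lin m a) := by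
  unfold AA
  let e : F ≃ TG 1 F :=
    { toFun := fun a => fun _ => -a
      invFun := fun c => -c 0
      left_inv := fun a => by simp
      right_inv := fun c => by
        funext i
        have : i = 0 := Subsingleton.elim _ _
        subst this
        simp }
  rw [← e.sum_comp]
  apply Finset.sum_congr rfl
  intro a _
  congr 1
  rw [lin, tr_eq_iff (ps_zero _) (lin0 _)]
  intro i _
  rw [coeff_ps]
  rcases i with _ | _ | i
  · simp [extW]
  · simp [extW, PowerSeries.coeff_one]
    rfl
  · simp [extW, PowerSeries.coeff_one, PowerSeries.coeff_X, PowerSeries.coeff_succ_mul_X, PowerSeries.coeff_C]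

theorem lin_zero : lin m (0 : F) = 1 := by
  rw [lin, map_zero, zero_mul, sub_zero, tr_one]

theorem chi_norm (χ : TG m F →* ℂ) (a : TG m F) : ‖χ a‖ = 1 := by
  apply Complex.norm_eq_one_of_pow_eq_one (n := Fintype.card (TG m F))
  · rw [← map_pow, pow_card_eq_one, map_one]
  · exact Fintype.card_ne_zero

theorem chi_sum (p : ℕ) [Fact p.Prime] [CharP F p] [DecidableEq F] (hm : 1 ≤ m) (χ : TG m F →* ℂ) (hχ : χ ≠ 1) :
    ‖∑ a : {a : F // a ≠ 0}, χ (lin m a.1)‖ ≤ m * Real.sqrt (Fintype.card F) := by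
  classical
  have h1 := AA_bound p hm χ hχ 1
  rw [AA_one, pow_one, Nat.choose_one_right] at h1
  have h2 : ∑ a : F, χ (lin m a) = 1 + ∑ a : {a : F // a ≠ 0}, χ (lin m a.1) := by
    rw [← Finset.sum_subtype (Finset.univ.erase (0 : F)) (by simp) (fun a => χ (lin m a)),
      ← Finset.add_sum_erase _ _ (Finset.mem_univ (0 : F)), lin_zero, map_one]
  have h3 : ∑ a : {a : F // a ≠ 0}, χ (lin m a.1) = ∑ a : F, χ (lin m a) - 1 := by rw [h2]; ring
  rw [h3]
  refine (norm_sub_le _ _).trans ?_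
  rw [norm_one]
  have h4 : (1 : ℝ) ≤ Real.sqrt (Fintype.card F) := by
    rw [Real.one_le_sqrt]; exact_mod_cast Fintype.card_pos
  rw [Nat.cast_sub hm, Nat.cast_one] at h1
  nlinarith

theorem chi_pow (p : ℕ) [hp : Fact p.Prime] [CharP F p] (χ : TG m F →* ℂ) (hχ : χ ≠ 1) (j : ℕ)
    (h : χ ^ j = 1) : p ∣ j := by
  by_contra hd
  apply hχ
  obtain ⟨n, -, hn⟩ := FiniteField.card F p
  have hc : Nat.Coprime j (Fintype.card (TG m F)) := by
    rw [card_eq, hn]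
    exact (((Nat.Prime.coprime_iff_not_dvd hp.out).2 hd).symm.pow_right _).pow_right _
  ext a
  have h1 : χ a ^ j = 1 := by rw [← MonoidHom.pow_apply, h]; rfl
  have h2 : χ a ^ Fintype.card (TG m F) = 1 := by rw [← map_pow, pow_card_eq_one, map_one]
  have h3 : χ a ^ (Nat.gcd j (Fintype.card (TG m F))) = 1 := pow_gcd_eq_one.2 ⟨h1, h2⟩
  rw [hc, pow_one] at h3
  exact h3

theorem S_bound (p : ℕ) [hp : Fact p.Prime] [CharP F p] [DecidableEq F] (hm : 1 ≤ m) (χ : TG m F →* ℂ) (hχ : χ ≠ 1) (r : ℕ) :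
    ‖∑ x : Fin r ↪ {a : F // a ≠ 0}, ∏ j, χ (lin m (x j).1)‖ ≤
      ∏ j ∈ Finset.range r, (((Fintype.card F : ℝ) - 1) / p + m * Real.sqrt (Fintype.card F) + j) := by
  have hc1 : (1 : ℝ) ≤ Fintype.card F := by exact_mod_cast Fintype.card_pos
  have h4 : (1 : ℝ) ≤ Real.sqrt (Fintype.card F) := by
    rw [Real.one_le_sqrt]; exact hc1
  have hm' : (1 : ℝ) ≤ m := by exact_mod_cast hm
  have hp0 : (0 : ℝ) < p := by exact_mod_cast hp.out.pos
  refine sieve_bound (σ := {a : F // a ≠ 0}) (fun a => χ (lin m a.1)) p hp.out.one_le _ _ (by linarith) ?_ ?_ r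
  · have : 0 ≤ ((Fintype.card F : ℝ) - 1) / p := div_nonneg (by linarith) hp0.le
    nlinarith
  · intro j hj
    by_cases hd : χ ^ j = 1
    · rw [if_pos (chi_pow p χ hχ j hd)]
      have h1 : ‖∑ a : {a : F // a ≠ 0}, χ (lin m a.1) ^ j‖ ≤ (Fintype.card F : ℝ) - 1 := by
        refine (norm_sum_le _ _).trans ?_
        simp only [norm_pow, chi_norm, one_pow]
        rw [Finset.sum_const, Finset.card_univ, Fintype.card_subtype_compl, Fintype.card_subtype_eq,
          nsmul_eq_mul, mul_one, Nat.cast_sub Fintype.card_pos, Nat.cast_one]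
      have : 0 ≤ m * Real.sqrt (Fintype.card F) := by positivity
      linarith
    · have h1 := chi_sum p hm (χ ^ j) hd
      have h2 : (0 : ℝ) ≤ if p ∣ j then (Fintype.card F : ℝ) - 1 else 0 := by split_ifs <;> linarith
      simp only [MonoidHom.pow_apply] at h1
      linarith

end
end TG

end Part11

section Part12
open Polynomial

namespace TG
section
variable {m : ℕ} {F : Type*} [Field F] [Fintype F]

/-- character as a monoid hom -/
noncomputable def hom (ψ : AddChar (Additive (TG m F)) ℂ) : TG m F →* ℂ where
  toFun a := ψ (Additive.ofMul a)
  map_one' := ψ.map_zero_eq_one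
  map_mul' a b := ψ.map_add_eq_mul (Additive.ofMul a) (Additive.ofMul b)

theorem hom_ne (ψ : AddChar (Additive (TG m F)) ℂ) (h : ψ ≠ 0) : hom ψ ≠ 1 := by
  intro h1
  apply h
  ext a
  exact DFunLike.congr_fun h1 (Additive.toMul a)

theorem hom_zero : hom (0 : AddChar (Additive (TG m F)) ℂ) = 1 := rfl

theorem hom_sum (a : TG m F) : ∑ ψ : AddChar (Additive (TG m F)) ℂ, hom ψ a =
    if a = 1 then ((Fintype.card F : ℂ)) ^ m else 0 := by
  have h := AddChar.sum_apply_eq_ite (Additive.ofMul a)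
  have h2 : Fintype.card (Additive (TG m F)) = Fintype.card F ^ m := by
    rw [← card_eq (m := m)]; exact Fintype.card_congr Additive.toMul
  rw [h2] at h
  push_cast at h
  exact h

/-- the solution set -/
noncomputable def Sol [DecidableEq F] (n r : ℕ) (T : TG m F) : Finset ((Fin r ↪ {a : F // a ≠ 0}) × TG n F) :=
  Finset.univ.filter (fun y => (∏ j, lin m (y.1 j).1) * tr m (ps y.2) = T)

theorem count [DecidableEq F] (n r : ℕ) (T : TG m F) : ((Fintype.card F : ℂ)) ^ m * (Sol n r T).card =
    ∑ ψ : AddChar (Additive (TG m F)) ℂ, hom ψ T⁻¹ *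
      ((∑ x : Fin r ↪ {a : F // a ≠ 0}, ∏ j, hom ψ (lin m (x j).1)) * AA (hom ψ) n) := by
  have h1 : ((Fintype.card F : ℂ)) ^ m * (Sol n r T).card =
      ∑ y : (Fin r ↪ {a : F // a ≠ 0}) × TG n F, ∑ ψ : AddChar (Additive (TG m F)) ℂ,
        hom ψ (T⁻¹ * ((∏ j, lin m (y.1 j).1) * tr m (ps y.2))) := by
    simp only [hom_sum]
    rw [← Finset.sum_filter, Finset.sum_const, nsmul_eq_mul, mul_comm]
    congr 3
    unfold Sol
    apply Finset.filter_congr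
    intro y _
    rw [inv_mul_eq_one, eq_comm]
  rw [h1, Finset.sum_comm]
  apply Finset.sum_congr rfl
  intro ψ _
  simp only [map_mul, map_prod]
  rw [← Finset.mul_sum, AA, Finset.sum_mul_sum, Fintype.sum_prod_type]

theorem count_bound (p : ℕ) [hp : Fact p.Prime] [CharP F p] [DecidableEq F] (hm : 1 ≤ m) (n r : ℕ) (T : TG m F) :
    |((Sol n r T).card : ℝ) - ((Fintype.card F - 1).descFactorial r : ℝ) * (Fintype.card F : ℝ) ^ n / (Fintype.card F : ℝ) ^ m| ≤
      (∏ j ∈ Finset.range r, (((Fintype.card F : ℝ) - 1) / p + m * Real.sqrt (Fintype.card F) + j)) *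
      ((m - 1).choose n * Real.sqrt (Fintype.card F) ^ n) := by
  classical
  set q : ℕ := Fintype.card F with hq
  have hq0 : (0 : ℝ) < q := by exact_mod_cast Fintype.card_pos
  set P := ∏ j ∈ Finset.range r, (((q : ℝ) - 1) / p + m * Real.sqrt q + j)
  set Bd := P * ((m - 1).choose n * Real.sqrt q ^ n) with hBd
  have h0 := count n r T
  rw [← Finset.add_sum_erase _ _ (Finset.mem_univ 0), hom_zero] at h0
  have hAA : AA (1 : TG m F →* ℂ) n = (q : ℂ) ^ n := by
    unfold AA
    simp only [MonoidHom.one_apply, Finset.sum_const, Finset.card_univ, card_eq, nsmul_eq_mul, mul_one]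
    push_cast; rfl
  have hS : (∑ x : Fin r ↪ {a : F // a ≠ 0}, ∏ j, (1 : TG m F →* ℂ) (lin m (x j).1)) = ((q - 1).descFactorial r : ℂ) := by
    simp only [MonoidHom.one_apply, Finset.prod_const_one, Finset.sum_const, Finset.card_univ, nsmul_eq_mul, mul_one]
    rw [Fintype.card_embedding_eq, Fintype.card_subtype_compl, Fintype.card_subtype_eq, Fintype.card_fin]
  rw [hAA, hS, MonoidHom.one_apply, one_mul] at h0
  have hb : ∀ ψ ∈ (Finset.univ : Finset (AddChar (Additive (TG m F)) ℂ)).erase 0, ‖hom ψ T⁻¹ *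
      ((∑ x : Fin r ↪ {a : F // a ≠ 0}, ∏ j, hom ψ (lin m (x j).1)) * AA (hom ψ) n)‖ ≤ Bd := by
    intro ψ hψ
    have hne := hom_ne ψ (Finset.ne_of_mem_erase hψ)
    rw [norm_mul, chi_norm, one_mul, norm_mul]
    have h1 := S_bound p hm (hom ψ) hne r
    exact mul_le_mul h1 (AA_bound p hm (hom ψ) hne n) (norm_nonneg _) ((norm_nonneg _).trans h1)
  have hcard : ((Finset.univ : Finset (AddChar (Additive (TG m F)) ℂ)).erase 0).card ≤ q ^ m := by
    refine (Finset.card_le_univ _).trans ?_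
    rw [AddChar.card_eq, hq, ← card_eq (m := m)]
    exact (Fintype.card_congr Additive.toMul).le
  have hBd0 : 0 ≤ Bd := by
    have : 0 ≤ P := by
      apply Finset.prod_nonneg
      intro j _
      have h1 : (1 : ℝ) ≤ q := by exact_mod_cast Fintype.card_pos
      have : 0 ≤ ((q : ℝ) - 1) / p := div_nonneg (by linarith) (by positivity)
      positivity
    positivity
  have h2 : ‖((q : ℂ)) ^ m * (Sol n r T).card - ((q - 1).descFactorial r : ℂ) * (q : ℂ) ^ n‖ ≤ (q : ℝ) ^ m * Bd := by
    rw [h0, add_sub_cancel_left]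
    refine (norm_sum_le _ _).trans ((Finset.sum_le_card_nsmul _ _ _ hb).trans ?_)
    rw [nsmul_eq_mul]
    exact mul_le_mul_of_nonneg_right (by exact_mod_cast hcard) hBd0
  have h3 : ((q : ℂ)) ^ m * (Sol n r T).card - ((q - 1).descFactorial r : ℂ) * (q : ℂ) ^ n =
      (((q : ℝ) ^ m * ((Sol n r T).card - ((q - 1).descFactorial r : ℝ) * (q : ℝ) ^ n / (q : ℝ) ^ m) : ℝ) : ℂ) := by
    rw [mul_sub, mul_div_cancel₀ _ (by positivity)]
    push_cast
    rfl
  rw [h3, Complex.norm_real, norm_mul, norm_pow, Real.norm_of_nonneg hq0.le, Real.norm_eq_abs] at h2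
  exact le_of_mul_le_mul_left h2 (by positivity)

theorem ps_tr_poly {n : ℕ} (h : F[X]) (hd : h.degree ≤ (n : WithBot ℕ)) (h0 : h.coeff 0 = 1) :
    ps (tr n (h : PowerSeries F)) = (h : PowerSeries F) := by
  ext i
  by_cases hi : i ≤ n
  · exact agree_ps_tr (by rw [coeff_coe, h0]) i hi
  · rw [coeff_ps, coeff_coe, coeff_eq_zero_of_degree_lt (hd.trans_lt (by exact_mod_cast not_le.1 hi))]
    rcases i with _ | i
    · omega
    · simp only [extW]; rw [dif_neg (by omega)]

theorem cond_iff {r : ℕ} (x : Fin r → F) (h f : F[X]) (h0 : h.coeff 0 = 1) (f0 : f.coeff 0 = 1) :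
    (∀ i ≤ m, ((∏ j : Fin r, (1 - Polynomial.C (x j) * X)) * h).coeff i = f.coeff i) ↔
      (∏ j, lin m (x j)) * tr m (h : PowerSeries F) = tr m (f : PowerSeries F) := by
  have hp := tr_prod (m := m) Finset.univ (fun j : Fin r => (1 - PowerSeries.C (x j) * PowerSeries.X : PowerSeries F))
    (fun j _ => lin0 (x j))
  have h0' : PowerSeries.coeff 0 (h : PowerSeries F) = 1 := by rw [coeff_coe, h0]
  have f0' : PowerSeries.coeff 0 (f : PowerSeries F) = 1 := by rw [coeff_coe, f0]
  have e : (((∏ j : Fin r, (1 - Polynomial.C (x j) * X)) * h : F[X]) : PowerSeries F) =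
      (∏ j : Fin r, (1 - PowerSeries.C (x j) * PowerSeries.X : PowerSeries F)) * (h : PowerSeries F) := by
    rw [Polynomial.coe_mul]
    congr 1
    rw [← Polynomial.coeToPowerSeries.ringHom_apply, map_prod]
    apply Finset.prod_congr rfl
    intro j _
    simp
  have e2 : (∏ j, lin m (x j)) = ∏ j : Fin r, tr m (1 - PowerSeries.C (x j) * PowerSeries.X : PowerSeries F) := rfl
  rw [e2, ← hp.2, ← tr_mul hp.1 h0', tr_eq_iff (coeff0_mul hp.1 h0') f0', ← e]
  simp only [Agree, coeff_coe]

theorem card_sol [DecidableEq F] (n r : ℕ) (f : F[X]) (hf0 : f.coeff 0 = 1) :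
    Nat.card {xh : (Fin r → F) × Polynomial F //
          Function.Injective xh.1 ∧ (∀ j, xh.1 j ≠ 0) ∧
          xh.2.degree ≤ (n : WithBot ℕ) ∧ xh.2.coeff 0 = 1 ∧
          ∀ i ≤ m, ((∏ j : Fin r, (1 - Polynomial.C (xh.1 j) * X)) * xh.2).coeff i
            = f.coeff i} = (Sol n r (tr m (f : PowerSeries F))).card := by
  rw [← Fintype.card_coe, ← Nat.card_eq_fintype_card]
  refine Nat.card_congr (Equiv.mk
    (fun y => ⟨(⟨fun j => ⟨y.1.1 j, y.2.2.1 j⟩, fun a b hab => y.2.1 (Subtype.ext_iff.1 hab)⟩,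
      tr n (y.1.2 : PowerSeries F)), ?_⟩)
    (fun y => ⟨(fun j => (y.1.1 j).1, PowerSeries.trunc (n + 1) (ps y.1.2)), ?_⟩) ?_ ?_)
  · obtain ⟨⟨x, h⟩, h1, h2, h3, h4, h5⟩ := y
    rw [Sol, Finset.mem_filter]
    refine ⟨Finset.mem_univ _, ?_⟩
    change (∏ j, lin m (x j)) * tr m (ps (tr n (h : PowerSeries F))) = _
    rw [ps_tr_poly h h3 h4]
    exact (cond_iff x h f h4 hf0).1 h5
  · obtain ⟨⟨x, c⟩, hy⟩ := y
    rw [Sol, Finset.mem_filter] at hy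
    have h0 : (PowerSeries.trunc (n + 1) (ps c)).coeff 0 = 1 := by
      rw [PowerSeries.coeff_trunc, if_pos (by omega), ps_zero]
    refine ⟨fun a b hab => x.injective (Subtype.ext hab), fun j => (x j).2, ?_, h0, ?_⟩
    · exact Order.lt_succ_iff.1 (PowerSeries.degree_trunc_lt _ _)
    · refine (cond_iff (fun j => (x j).1) _ f h0 hf0).2 ?_
      rw [coe_trunc]
      exact hy.2
  · rintro ⟨⟨x, h⟩, h1, h2, h3, h4, h5⟩
    apply Subtype.ext
    refine Prod.ext rfl ?_
    change PowerSeries.trunc (n + 1) (ps (tr n (h : PowerSeries F))) = h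
    apply Polynomial.coe_injective F
    rw [coe_trunc, ps_tr_poly h h3 h4]
  · rintro ⟨⟨x, c⟩, hy⟩
    apply Subtype.ext
    refine Prod.ext rfl ?_
    change tr n ((PowerSeries.trunc (n + 1) (ps c) : F[X]) : PowerSeries F) = c
    rw [coe_trunc, tr_ps]

end
end TG


end Part12

open Polynomial

/-- For `f` with `f(0) = 1`, `d = k+m ≤ q-1` and `k+1 ≤ r ≤ d`, the number
`N_2^*` of pairs `((x_1,…,x_r), h)` with the `x_i ∈ F_q^*` pairwise distinct,
`deg h ≤ d-r`, `h(0) = 1`, and `(1-x_1x)⋯(1-x_rx)h(x) ≡ f(x) (mod x^(m+1))` satisfies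
`|N_2^* - (q-1)_r q^(k-r)| ≤ ((q-1)/p + m√q + r - 1)_r C(m-1, d-r) q^((d-r)/2)`. -/
theorem stmt_14 {F : Type*} [Field F] [Fintype F] [DecidableEq F]
    (q p : ℕ) (hcard : Fintype.card F = q) [hp : Fact p.Prime] [CharP F p]
    (k m r : ℕ) (hk : 1 ≤ k) (hkm : k + m ≤ q - 1)
    (hr1 : k + 1 ≤ r) (hr2 : r ≤ k + m)
    (f : Polynomial F) (hf0 : f.coeff 0 = 1) :
    |(Nat.card {xh : (Fin r → F) × Polynomial F //
          Function.Injective xh.1 ∧ (∀ j, xh.1 j ≠ 0) ∧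
          xh.2.degree ≤ ((k + m - r : ℕ) : WithBot ℕ) ∧ xh.2.coeff 0 = 1 ∧
          ∀ i ≤ m, ((∏ j : Fin r, (1 - Polynomial.C (xh.1 j) * X)) * xh.2).coeff i
            = f.coeff i} : ℝ)
        - fallFac ((q : ℝ) - 1) r * (q : ℝ) ^ ((k : ℤ) - (r : ℤ))|
      ≤ fallFac (((q : ℝ) - 1) / (p : ℝ) + (m : ℝ) * Real.sqrt q + (r : ℝ) - 1) r *
          ((m - 1).choose (k + m - r) : ℝ) * Real.sqrt q ^ (k + m - r) := by
  have hb := TG.count_bound (F := F) p (m := m) (by omega) (k + m - r) r (TG.tr m (f : PowerSeries F))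
  rw [← TG.card_sol _ _ f hf0, hcard] at hb
  have hq1 : 1 ≤ q := by rw [← hcard]; exact Fintype.card_pos
  have hq0 : (q : ℝ) ≠ 0 := by positivity
  have e1 : fallFac ((q : ℝ) - 1) r = ((q - 1).descFactorial r : ℝ) := by
    rw [← descPochhammer_eval_eq_descFactorial, descPochhammer_eval_eq_prod_range, fallFac,
      Nat.cast_sub hq1, Nat.cast_one]
  have e2 : fallFac (((q : ℝ) - 1) / (p : ℝ) + (m : ℝ) * Real.sqrt q + (r : ℝ) - 1) r =
      ∏ j ∈ Finset.range r, (((q : ℝ) - 1) / p + m * Real.sqrt q + j) := by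
    rw [fallFac, ← Finset.prod_range_reflect]
    apply Finset.prod_congr rfl
    intro j hj
    rw [Finset.mem_range] at hj
    rw [Nat.cast_sub (by omega), Nat.cast_sub (by omega)]
    push_cast
    ring
  have e3 : (q : ℝ) ^ ((k : ℤ) - (r : ℤ)) = (q : ℝ) ^ (k + m - r) / (q : ℝ) ^ m := by
    rw [← zpow_natCast, ← zpow_natCast, ← zpow_sub₀ hq0]
    congr 1
    omega
  rw [e1, e2, e3, ← mul_div_assoc, mul_assoc]
  exact hb
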